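/- arXiv:2105.04784 — 4 statements merged into one kernel-verified Lean document; each statement's English description precedes it below -/
import Mathlib

section
/- Let q be an odd prime power not divisible by 3 with q ≡ 2 (mod 3). The number of orbits of S₃ acting on {(α : β) ∈ P¹(F_q) : α ≠ 0, β ≠ 0, α + β ≠ 0} via the action generated by (α : β) ↦ (β : α) and (α : β) ↦ (α : -(α + β)) equals (q+1)/6. -/
/-- The set `{(α, β) : αβ(α+β) ≠ 0}`, whose classes up to scalar form
`{(α : β) ∈ P¹(F_q) : α ≠ 0, β ≠ 0, α + β ≠ 0}`. -/
def goodPairs (F : Type*) [Field F] : Type _ :=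
  {p : F × F // p.1 ≠ 0 ∧ p.2 ≠ 0 ∧ p.1 + p.2 ≠ 0}

/-- Orbit relation on projective classes of good pairs under the `S₃`-action permuting
`α, β, γ = -(α+β)`: two pairs are related iff one is a nonzero scalar multiple of one of the
six images `(α,β), (β,α), (α,-(α+β)), (-(α+β),β), (-(α+β),α), (β,-(α+β))` of the other. -/
def relS3 (F : Type*) [Field F] (p q : goodPairs F) : Prop :=
  ∃ l : F, l ≠ 0 ∧ (
    q.1 = (l * p.1.1, l * p.1.2) ∨
    q.1 = (l * p.1.2, l * p.1.1) ∨
    q.1 = (l * p.1.1, l * (-(p.1.1 + p.1.2))) ∨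
    q.1 = (l * (-(p.1.1 + p.1.2)), l * p.1.2) ∨
    q.1 = (l * (-(p.1.1 + p.1.2)), l * p.1.1) ∨
    q.1 = (l * p.1.2, l * (-(p.1.1 + p.1.2))))

/-- The `S₃`-invariant `(α² + αβ + β²)³ / (αβ(α+β))²` of a projective class `(α : β)`. -/
def jInv {F : Type*} [Field F] (p : F × F) : F :=
  (p.1 ^ 2 + p.1 * p.2 + p.2 ^ 2) ^ 3 / (p.1 * p.2 * (p.1 + p.2)) ^ 2

theorem jInv_eq_of_relS3 {F : Type*} [Field F] {p r : goodPairs F} (h : relS3 F p r) :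
    jInv p.1 = jInv r.1 := by
  obtain ⟨⟨a, b⟩, ha, hb, hab⟩ := p
  obtain ⟨r, hr⟩ := r
  obtain ⟨l, hl, h⟩ := h
  simp only at h ha hb hab ⊢
  obtain ⟨hr1, hr2, hr3⟩ := hr
  have hD : a * b * (a + b) ≠ 0 := mul_ne_zero (mul_ne_zero ha hb) hab
  have hE : r.1 * r.2 * (r.1 + r.2) ≠ 0 := mul_ne_zero (mul_ne_zero hr1 hr2) hr3
  unfold jInv
  rw [div_eq_div_iff (pow_ne_zero 2 hD) (pow_ne_zero 2 hE)]
  rcases h with h | h | h | h | h | h <;> rw [h] <;> ring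

/-- Pairs with the same invariant are proportional to one of the six permuted pairs. -/
theorem jInv_eq_cases {F : Type*} [Field F] {a b c d : F}
    (hD : a * b * (a + b) ≠ 0) (hE : c * d * (c + d) ≠ 0) (h : jInv (a, b) = jInv (c, d)) :
    c * b = d * a ∨ c * a = d * b ∨ c * -(a + b) = d * a ∨ c * b = d * -(a + b) ∨
      c * a = d * -(a + b) ∨ c * -(a + b) = d * b := by
  unfold jInv at h
  rw [div_eq_div_iff (pow_ne_zero 2 hD) (pow_ne_zero 2 hE)] at h
  have key : (c * b - d * a) * ((c * a - d * b) * ((c * -(a + b) - d * a) *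
      ((c * b - d * -(a + b)) * ((c * a - d * -(a + b)) * (c * -(a + b) - d * b))))) = 0 := by
    simp only at h
    linear_combination -h
  simpa only [mul_eq_zero, sub_eq_zero] using key

theorem relS3_of_jInv_eq {F : Type*} [Field F] {p r : goodPairs F} (h : jInv p.1 = jInv r.1) :
    relS3 F p r := by
  obtain ⟨⟨a, b⟩, ha, hb, hab⟩ := p
  obtain ⟨⟨c, d⟩, hc, hd, hcd⟩ := r
  simp only at ha hb hab hc hd hcd h
  have hn : -(a + b) ≠ 0 := neg_ne_zero.mpr hab
  have scale : ∀ {x y : F}, x ≠ 0 → y ≠ 0 → c * y = d * x →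
      c / x ≠ 0 ∧ (c, d) = (c / x * x, c / x * y) := by
    intro x y hx hy e
    refine ⟨div_ne_zero hc hx, Prod.ext ?_ ?_⟩
    · simp [hx]
    · simp only
      field_simp
      exact e.symm
  rcases jInv_eq_cases (mul_ne_zero (mul_ne_zero ha hb) hab)
    (mul_ne_zero (mul_ne_zero hc hd) hcd) h with e | e | e | e | e | e
  · exact ⟨_, (scale ha hb e).1, Or.inl (scale ha hb e).2⟩
  · exact ⟨_, (scale hb ha e).1, Or.inr (Or.inl (scale hb ha e).2)⟩
  · exact ⟨_, (scale ha hn e).1, Or.inr (Or.inr (Or.inl (scale ha hn e).2))⟩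
  · exact ⟨_, (scale hn hb e).1, Or.inr (Or.inr (Or.inr (Or.inl (scale hn hb e).2)))⟩
  · exact ⟨_, (scale hn ha e).1,
      Or.inr (Or.inr (Or.inr (Or.inr (Or.inl (scale hn ha e).2))))⟩
  · exact ⟨_, (scale hb hn e).1,
      Or.inr (Or.inr (Or.inr (Or.inr (Or.inr (scale hb hn e).2))))⟩

/-- The affine coordinates `t = α / β` of the classes of good pairs. -/
def goodCoords (F : Type*) [Field F] [Fintype F] [DecidableEq F] : Finset F :=
  Finset.univ \ {0, -1}

theorem mem_goodCoords {F : Type*} [Field F] [Fintype F] [DecidableEq F] {t : F} :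
    t ∈ goodCoords F ↔ t ≠ 0 ∧ t + 1 ≠ 0 := by
  simp [goodCoords, eq_neg_iff_add_eq_zero]

theorem card_goodCoords (F : Type*) [Field F] [Fintype F] [DecidableEq F] :
    (goodCoords F).card + 2 = Fintype.card F := by
  have h : ({0, -1} : Finset F).card = 2 := Finset.card_pair (by simp)
  rw [← h, goodCoords, Finset.card_sdiff_add_card_eq_card (Finset.subset_univ _),
    Finset.card_univ]

theorem natCard_quot_relS3 (F : Type*) [Field F] [Fintype F] [DecidableEq F] :
    Nat.card (Quot (relS3 F)) = ((goodCoords F).image fun t => jInv (t, 1)).card := by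
  let g : Quot (relS3 F) → F := Quot.lift (fun p => jInv p.1) fun _ _ => jInv_eq_of_relS3
  have hg : Function.Injective g := by
    rintro ⟨p⟩ ⟨r⟩ h
    exact Quot.sound (relS3_of_jInv_eq h)
  have hrange : Set.range g = ((goodCoords F).image fun t => jInv (t, 1) : Finset F) := by
    ext x
    simp only [Set.mem_range, Finset.coe_image, Set.mem_image, Finset.mem_coe, mem_goodCoords]
    constructor
    · rintro ⟨⟨⟨⟨a, b⟩, ha, hb, hab⟩⟩, rfl⟩
      simp only at ha hb hab
      refine ⟨a / b, ⟨div_ne_zero ha hb, ?_⟩, ?_⟩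
      · rw [div_add_one hb]
        exact div_ne_zero hab hb
      · change jInv (a / b, 1) = jInv (a, b)
        simp only [jInv]
        field_simp
    · rintro ⟨t, ⟨h0, h1⟩, rfl⟩
      exact ⟨Quot.mk _ ⟨(t, 1), h0, one_ne_zero, h1⟩, rfl⟩
  rw [← Nat.card_range_of_injective hg, hrange, Nat.card_coe_set_eq, Set.ncard_coe_finset]

theorem natCast_prime_ne_zero_of_not_dvd_card {F : Type*} [Field F] [Fintype F] {p : ℕ}
    (hp : p.Prime) (h : ¬ p ∣ Fintype.card F) : (p : F) ≠ 0 := by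
  intro h0
  have := Fact.mk hp
  have h1 : addOrderOf (1 : F) = p := addOrderOf_eq_prime (by simpa using h0) one_ne_zero
  exact h (h1 ▸ addOrderOf_dvd_card)

theorem sq_add_self_add_one_ne_zero {F : Type*} [Field F] [Fintype F] (h3 : (3 : F) ≠ 0)
    (hmod : Fintype.card F % 3 = 2) (t : F) : t ^ 2 + t + 1 ≠ 0 := by
  classical
  intro h
  have ht : t ≠ 0 := by
    rintro rfl
    simp at h
  have h1 : Units.mk0 t ht ≠ 1 := by
    intro e
    have e' : t = 1 := congrArg Units.val e
    subst e'
    exact h3 (by linear_combination h)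
  have ho : orderOf (Units.mk0 t ht) = 3 := by
    have : Fact (Nat.Prime 3) := ⟨Nat.prime_three⟩
    refine orderOf_eq_prime (Units.ext ?_) h1
    simp only [Units.val_pow_eq_pow_val, Units.val_mk0, Units.val_one]
    linear_combination (t - 1) * h
  have hd : 3 ∣ Fintype.card Fˣ := ho ▸ orderOf_dvd_card
  rw [Fintype.card_units] at hd
  omega

theorem jInv_one_fiber {F : Type*} [Field F] [Fintype F] [DecidableEq F] {t : F}
    (ht : t ∈ goodCoords F) :
    {s ∈ goodCoords F | jInv (s, 1) = jInv (t, 1)} =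
      {t, t⁻¹, -(t / (t + 1)), -(t + 1), -((t + 1) / t), -(t + 1)⁻¹} := by
  obtain ⟨h0, h1⟩ := mem_goodCoords.mp ht
  ext s
  simp only [Finset.mem_filter, mem_goodCoords, Finset.mem_insert, Finset.mem_singleton]
  constructor
  · rintro ⟨⟨hs0, hs1⟩, h⟩
    have := jInv_eq_cases (a := t) (b := 1) (c := s) (d := 1) (by simp [h0, h1])
      (by simp [hs0, hs1]) h.symm
    rcases this with e | e | e | e | e | e
    · left; linear_combination e
    · right; left; field_simp; linear_combination e
    · right; right; left; field_simp; linear_combination -e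
    · right; right; right; left; linear_combination e
    · right; right; right; right; left; field_simp; linear_combination e
    · right; right; right; right; right; field_simp; linear_combination -e
  · have good : ∀ {x : F}, x ≠ 0 → x + 1 ≠ 0 →
        (t ^ 2 + t + 1) ^ 3 * (x * (x + 1)) ^ 2 = (x ^ 2 + x + 1) ^ 3 * (t * (t + 1)) ^ 2 →
        (x ≠ 0 ∧ x + 1 ≠ 0) ∧ jInv (x, 1) = jInv (t, 1) := by
      intro x hx0 hx1 e
      refine ⟨⟨hx0, hx1⟩, ?_⟩
      simp only [jInv, mul_one, one_pow]
      rw [div_eq_div_iff (by simp [hx0, hx1]) (by simp [h0, h1])]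
      exact e.symm
    rintro (rfl | rfl | rfl | rfl | rfl | rfl)
    · exact good h0 h1 rfl
    · refine good (by simp [h0]) ?_ (by field_simp; ring)
      rw [show t⁻¹ + 1 = (t + 1) / t by field_simp; ring]
      exact div_ne_zero h1 h0
    · refine good (by simp [h0, h1]) ?_ (by field_simp; ring)
      rw [show -(t / (t + 1)) + 1 = (t + 1)⁻¹ by field_simp; ring]
      exact inv_ne_zero h1
    · refine good (neg_ne_zero.mpr h1) ?_ (by ring)
      rw [show -(t + 1) + 1 = -t by ring]
      exact neg_ne_zero.mpr h0
    · refine good (by simp [h0, h1]) ?_ (by field_simp; ring)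
      rw [show -((t + 1) / t) + 1 = -t⁻¹ by field_simp; ring]
      exact neg_ne_zero.mpr (inv_ne_zero h0)
    · refine good (by simp [h1]) ?_ (by field_simp; ring)
      rw [show -(t + 1)⁻¹ + 1 = t / (t + 1) by field_simp; ring]
      exact div_ne_zero h0 h1

theorem card_jInv_one_fiber_one {F : Type*} [Field F] [Fintype F] [DecidableEq F]
    (h2 : (2 : F) ≠ 0) (h3 : (3 : F) ≠ 0) :
    {s ∈ goodCoords F | jInv (s, 1) = jInv ((1 : F), 1)}.card = 3 := by
  have h11 : (1 : F) + 1 ≠ 0 := by rwa [one_add_one_eq_two]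
  rw [jInv_one_fiber (mem_goodCoords.mpr ⟨one_ne_zero, h11⟩), Finset.card_eq_three]
  refine ⟨1, -2, -2⁻¹, ?_, ?_, ?_, ?_⟩
  · intro e
    exact h3 (by linear_combination e)
  · intro e
    field_simp at e
    exact h3 (by linear_combination e)
  · intro e
    field_simp at e
    exact h3 (by linear_combination -e)
  · ext x
    simp only [one_add_one_eq_two, inv_one, one_div, div_one, Finset.mem_insert,
      Finset.mem_singleton]
    tauto

theorem card_jInv_one_fiber_of_ne {F : Type*} [Field F] [Fintype F] [DecidableEq F]
    (hroot : ∀ t : F, t ^ 2 + t + 1 ≠ 0) {t : F} (ht : t ∈ goodCoords F)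
    (h2 : (2 : F) ≠ 0) (hne : jInv (t, 1) ≠ jInv ((1 : F), 1)) :
    {s ∈ goodCoords F | jInv (s, 1) = jInv (t, 1)}.card = 6 := by
  obtain ⟨h0, h1⟩ := mem_goodCoords.mp ht
  have hprod : (t - 1) * (t + 2) * (2 * t + 1) ≠ 0 := by
    intro e
    apply hne
    simp only [jInv, mul_one, one_pow, one_mul]
    rw [div_eq_div_iff (by simp [h0, h1]) (by simp [one_add_one_eq_two, h2])]
    linear_combination ((t - 1) * (t + 2) * (2 * t + 1)) * e
  obtain ⟨⟨ha, hb⟩, hc⟩ : ((t - 1 ≠ 0) ∧ (t + 2 ≠ 0)) ∧ (2 * t + 1 ≠ 0) := by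
    simpa only [mul_ne_zero_iff] using hprod
  have hr := hroot t
  rw [jInv_one_fiber ht]
  repeat rw [Finset.card_insert_of_notMem]
  · simp
  all_goals
    simp only [Finset.mem_insert, Finset.mem_singleton, not_or]
    repeat' apply And.intro
  all_goals
    intro e
    field_simp at e
    grind

/-- For `q` an odd prime power with `q ≡ 2 (mod 3)` (in particular not divisible by 3),
the number of orbits of `S₃` on `{(α : β) ∈ P¹(F_q) : α ≠ 0, β ≠ 0, α + β ≠ 0}`
is `(q+1)/6`. -/
theorem stmt_10 (F : Type*) [Field F] [Fintype F] (q : ℕ) (hq : Fintype.card F = q)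
    (hodd : Odd q) (h3 : ¬ 3 ∣ q) (hmod : q % 3 = 2) :
    6 * Nat.card (Quot (relS3 F)) = q + 1 := by
  classical
  subst hq
  have h2 : (2 : F) ≠ 0 := by
    exact_mod_cast natCast_prime_ne_zero_of_not_dvd_card (F := F) Nat.prime_two
      hodd.not_two_dvd_nat
  have h3' : (3 : F) ≠ 0 := by
    exact_mod_cast natCast_prime_ne_zero_of_not_dvd_card (F := F) Nat.prime_three h3
  have hroot := sq_add_self_add_one_ne_zero h3' hmod
  have hcard := card_goodCoords F
  have h11 : (1 : F) ∈ goodCoords F :=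
    mem_goodCoords.mpr ⟨one_ne_zero, by rwa [one_add_one_eq_two]⟩
  have hmem := Finset.mem_image_of_mem (fun t : F => jInv (t, 1)) h11
  have hsum := Finset.card_eq_sum_card_image (fun t : F => jInv (t, 1)) (goodCoords F)
  rw [← Finset.add_sum_erase _ _ hmem, card_jInv_one_fiber_one h2 h3',
    Finset.sum_const_nat (m := 6), Finset.card_erase_of_mem hmem] at hsum
  · have hpos := Finset.card_pos.mpr ⟨_, hmem⟩
    rw [natCard_quot_relS3]
    omega
  · intro x hx
    obtain ⟨hx1, hx2⟩ := Finset.mem_erase.mp hx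
    obtain ⟨t, ht, rfl⟩ := Finset.mem_image.mp hx2
    exact card_jInv_one_fiber_of_ne hroot ht h2 hx1
end

section
/- Let C be a nonsingular plane cubic over F_4 with exactly 9 F_4-points, and let ℓ₀ be an F_4-line meeting C(F_4) in exactly one point P. Then ℓ₀.C = 3P; in particular P is an inflection point and ℓ₀ is the tangent line to C at P. -/
open MvPolynomial

/-- The curve `f = 0` is nonsingular (smooth over an algebraic closure). -/
def IsNonsingularCubic (f : MvPolynomial (Fin 3) (GaloisField 2 2)) : Prop :=
  ∀ v : Fin 3 → AlgebraicClosure (GaloisField 2 2), v ≠ 0 →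
    eval v (MvPolynomial.map (algebraMap (GaloisField 2 2) (AlgebraicClosure (GaloisField 2 2))) f) = 0 →
    ∃ i, eval v (pderiv i (MvPolynomial.map
      (algebraMap (GaloisField 2 2) (AlgebraicClosure (GaloisField 2 2))) f)) ≠ 0

/-- The restriction of `f` to the line spanned by `u` and `w`, as a binary form `g(s,t)`
in the coordinates of the parametrization `(s : t) ↦ s·u + t·w`. The intersection divisor
`ℓ.C` is encoded by the factorization of this binary form. -/
noncomputable def lineRestrict (f : MvPolynomial (Fin 3) (GaloisField 2 2))
    (u w : Fin 3 → GaloisField 2 2) : MvPolynomial (Fin 2) (GaloisField 2 2) :=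
  aeval (fun i => C (u i) * X 0 + C (w i) * X 1) f

namespace MvPolynomial

/-- The ternary cubic form with coefficients `c`, in lexicographic order of the monomials. -/
noncomputable def ternaryCubic {R : Type*} [CommSemiring R] (c : Fin 10 → R) :
    MvPolynomial (Fin 3) R :=
  C (c 0) * X 0 ^ 3 + C (c 1) * X 0 ^ 2 * X 1 + C (c 2) * X 0 ^ 2 * X 2 + C (c 3) * X 0 * X 1 ^ 2 +
    C (c 4) * X 0 * X 1 * X 2 + C (c 5) * X 0 * X 2 ^ 2 + C (c 6) * X 1 ^ 3 +
    C (c 7) * X 1 ^ 2 * X 2 + C (c 8) * X 1 * X 2 ^ 2 + C (c 9) * X 2 ^ 3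

theorem IsHomogeneous.eq_sum_antidiagonalTuple {R : Type*} [CommSemiring R] {k n : ℕ}
    {f : MvPolynomial (Fin k) R} (hf : f.IsHomogeneous n) :
    f = ∑ m ∈ Finset.Nat.antidiagonalTuple k n,
      C (coeff (Finsupp.equivFunOnFinite.symm m) f) * ∏ i, X i ^ m i := by
  classical
  have hsub : f.support ⊆ (Finset.Nat.antidiagonalTuple k n).map
      Finsupp.equivFunOnFinite.symm.toEmbedding := by
    intro d hd
    have h := hf (mem_support_iff.mp hd)
    simp only [Finset.mem_map_equiv, Equiv.symm_symm, Finset.Nat.mem_antidiagonalTuple]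
    rw [← h, Finsupp.weight_apply, Finsupp.sum_fintype _ _ (by simp)]
    simp
  conv_lhs => rw [f.as_sum, Finset.sum_subset hsub (fun d _ hd => by
    rw [notMem_support_iff.mp hd, monomial_zero])]
  rw [Finset.sum_map]
  refine Finset.sum_congr rfl fun m _ => ?_
  rw [monomial_eq, Finsupp.prod_fintype _ _ (by simp)]
  rfl

theorem IsHomogeneous.exists_eq_ternaryCubic {R : Type*} [CommSemiring R]
    {f : MvPolynomial (Fin 3) R} (hf : f.IsHomogeneous 3) : ∃ c, f = ternaryCubic c := by
  have hset : Finset.Nat.antidiagonalTuple 3 3 = {![3, 0, 0], ![2, 1, 0], ![2, 0, 1], ![1, 2, 0],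
      ![1, 1, 1], ![1, 0, 2], ![0, 3, 0], ![0, 2, 1], ![0, 1, 2], ![0, 0, 3]} := by decide
  let k (m : Fin 3 → ℕ) : R := coeff (Finsupp.equivFunOnFinite.symm m) f
  refine ⟨![k ![3, 0, 0], k ![2, 1, 0], k ![2, 0, 1], k ![1, 2, 0], k ![1, 1, 1], k ![1, 0, 2],
    k ![0, 3, 0], k ![0, 2, 1], k ![0, 1, 2], k ![0, 0, 3]], ?_⟩
  conv_lhs => rw [hf.eq_sum_antidiagonalTuple, hset]
  simp +decide [ternaryCubic, Fin.prod_univ_three, k, add_assoc, mul_assoc]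

theorem pderiv_bind₁ {R σ τ : Type*} [CommSemiring R] [Fintype σ] (g : σ → MvPolynomial τ R)
    (j : τ) (f : MvPolynomial σ R) :
    pderiv j (bind₁ g f) = ∑ i, bind₁ g (pderiv i f) * pderiv j (g i) := by
  classical
  induction f using MvPolynomial.induction_on with
  | C a => simp
  | add p q hp hq => simp [hp, hq, add_mul, Finset.sum_add_distrib]
  | mul_X p i hp =>
    simp only [map_mul, bind₁_X_right, Derivation.leibniz, hp, pderiv_X, smul_eq_mul, map_add,
      add_mul, Finset.sum_add_distrib, Finset.mul_sum]
    congr 1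
    · simp [Pi.single_apply]
    · exact Finset.sum_congr rfl fun _ _ => by ring

/-- The form `f` in the coordinates given by the rows of `N`. -/
noncomputable def linearSubst {R σ τ : Type*} [CommSemiring R] [Fintype τ] (N : Matrix τ σ R)
    (f : MvPolynomial σ R) : MvPolynomial τ R :=
  bind₁ (fun i => ∑ j, C (N j i) * X j) f

theorem IsHomogeneous.linearSubst {R σ τ : Type*} [CommSemiring R] [Fintype τ] {n : ℕ}
    {f : MvPolynomial σ R} (hf : f.IsHomogeneous n) (N : Matrix τ σ R) :
    (linearSubst N f).IsHomogeneous n := by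
  have h := hf.aeval (g := fun i => ∑ j, C (N j i) * X j) (n := 1) fun i =>
    IsHomogeneous.sum _ _ _ fun j _ => 
      by simpa using (isHomogeneous_C τ (N j i)).mul (isHomogeneous_X R j)
  rwa [one_mul] at h

theorem eval_linearSubst {R σ τ : Type*} [CommSemiring R] [Fintype τ] (N : Matrix τ σ R)
    (f : MvPolynomial σ R) (v : τ → R) :
    eval v (linearSubst N f) = eval (Matrix.vecMul v N) f := by
  rw [linearSubst, ← coe_aeval_eq_eval, RingHom.coe_coe, aeval_bind₁, ← coe_aeval_eq_eval,
    RingHom.coe_coe]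
  congr 2
  ext i
  simp [Matrix.vecMul, dotProduct, mul_comm]

theorem map_linearSubst {R S σ τ : Type*} [CommSemiring R] [CommSemiring S] [Fintype τ]
    (φ : R →+* S) (N : Matrix τ σ R) (f : MvPolynomial σ R) :
    map φ (linearSubst N f) = linearSubst (N.map φ) (map φ f) := by
  simp [linearSubst, map_bind₁]

theorem eval_pderiv_linearSubst {R σ τ : Type*} [CommSemiring R] [Fintype σ] [Fintype τ]
    (N : Matrix τ σ R) (f : MvPolynomial σ R) (v : τ → R) (j : τ) :
    eval v (pderiv j (linearSubst N f)) =
      ∑ i, N j i * eval (Matrix.vecMul v N) (pderiv i f) := by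
  classical
  rw [linearSubst, pderiv_bind₁, map_sum]
  refine Finset.sum_congr rfl fun i _ => ?_
  rw [map_mul, mul_comm]
  congr 1
  · simp [pderiv_X, Pi.single_apply]
  · exact eval_linearSubst N _ v

theorem eval_ternaryCubic {R : Type*} [CommSemiring R] (c : Fin 10 → R) (v : Fin 3 → R) :
    eval v (ternaryCubic c) = c 0 * v 0 ^ 3 + c 1 * v 0 ^ 2 * v 1 + c 2 * v 0 ^ 2 * v 2 +
      c 3 * v 0 * v 1 ^ 2 + c 4 * v 0 * v 1 * v 2 + c 5 * v 0 * v 2 ^ 2 + c 6 * v 1 ^ 3 +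
      c 7 * v 1 ^ 2 * v 2 + c 8 * v 1 * v 2 ^ 2 + c 9 * v 2 ^ 3 := by
  simp [ternaryCubic]

theorem map_ternaryCubic {R S : Type*} [CommSemiring R] [CommSemiring S] (φ : R →+* S)
    (c : Fin 10 → R) : map φ (ternaryCubic c) = ternaryCubic (φ ∘ c) := by
  simp [ternaryCubic]

end MvPolynomial

theorem IsAlgClosed.exists_binary_quadratic_eq_zero {L : Type*} [Field L] [IsAlgClosed L]
    (a b c : L) : ∃ x y : L, (x ≠ 0 ∨ y ≠ 0) ∧ a * x ^ 2 + b * x * y + c * y ^ 2 = 0 := by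
  by_cases ha : a = 0
  · exact ⟨1, 0, by simp, by simp [ha]⟩
  · obtain ⟨x, hx⟩ := IsAlgClosed.exists_root
      (Polynomial.C a * Polynomial.X ^ 2 + Polynomial.C b * Polynomial.X + Polynomial.C c)
      (by rw [Polynomial.degree_quadratic ha]; decide)
    refine ⟨x, 1, by simp, ?_⟩
    simpa [Polynomial.IsRoot] using hx

/-- A cubic containing the line through `(1 : 0 : 0)` and `(0 : l : 1)` is singular. -/
theorem MvPolynomial.exists_singular_ternaryCubic {L : Type*} [Field L] [IsAlgClosed L]
    (c : Fin 10 → L) (l : L) (h0 : c 0 = 0) (h1 : c 1 * l + c 2 = 0)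
    (h2 : c 3 * l ^ 2 + c 4 * l + c 5 = 0)
    (h3 : c 6 * l ^ 3 + c 7 * l ^ 2 + c 8 * l + c 9 = 0) :
    ∃ v : Fin 3 → L, v ≠ 0 ∧ eval v (ternaryCubic c) = 0 ∧
      ∀ i, eval v (pderiv i (ternaryCubic c)) = 0 := by
  obtain ⟨x, y, hxy, hq⟩ := IsAlgClosed.exists_binary_quadratic_eq_zero (c 1)
    (2 * c 3 * l + c 4) (3 * c 6 * l ^ 2 + 2 * c 7 * l + c 8)
  refine ⟨![x, l * y, y], ?_, ?_, ?_⟩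
  · intro h
    have hx := congrFun h 0
    have hy := congrFun h 2
    simp only [Matrix.cons_val, Pi.zero_apply] at hx hy
    simp [hx, hy] at hxy
  · rw [eval_ternaryCubic]
    simp only [Matrix.cons_val]
    linear_combination x ^ 3 * h0 + x ^ 2 * y * h1 + x * y ^ 2 * h2 + y ^ 3 * h3
  · intro i
    fin_cases i <;>
      simp [ternaryCubic, pderiv_X, Derivation.leibniz_pow]
    · linear_combination 3 * x ^ 2 * h0 + 2 * x * y * h1 + y ^ 2 * h2
    · linear_combination hq
    · linear_combination x ^ 2 * h1 + 2 * x * y * h2 + 3 * y ^ 2 * h3 - l * hq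

theorem card_quadratic_zeros_le {K : Type*} [Field K] [Fintype K] [DecidableEq K] {a b c : K}
    (h : ¬(a = 0 ∧ b = 0 ∧ c = 0)) :
    (Finset.univ.filter fun x : K => a * x ^ 2 + b * x + c = 0).card ≤ if a = 0 then 1 else 2 := by
  set p : Polynomial K :=
    Polynomial.C a * Polynomial.X ^ 2 + Polynomial.C b * Polynomial.X + Polynomial.C c with hp
  have hp0 : p ≠ 0 := by
    intro h0
    refine h ⟨?_, ?_, ?_⟩
    · simpa [hp] using congrArg (Polynomial.coeff · 2) h0
    · simpa [hp, Polynomial.coeff_X] using congrArg (Polynomial.coeff · 1) h0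
    · simpa [hp] using congrArg (Polynomial.coeff · 0) h0
  have hdeg : p.natDegree ≤ if a = 0 then 1 else 2 := by
    split_ifs with ha
    · rw [hp, ha]
      simpa using Polynomial.natDegree_linear_le (a := b) (b := c)
    · exact Polynomial.natDegree_quadratic_le
  calc _ ≤ p.roots.toFinset.card := Finset.card_le_card fun x hx => by
        rw [Multiset.mem_toFinset, Polynomial.mem_roots hp0]
        simpa [hp] using hx
    _ ≤ p.natDegree := (Multiset.toFinset_card_le _).trans p.card_roots'
    _ ≤ _ := hdeg

/-- If a cubic through `(1 : 0 : 0)` containing none of the lines through `(1 : 0 : 0)` other than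
`z = 0` has at least `2 q` points off `z = 0`, and meets `z = 0` only in `(1 : 0 : 0)`, then it
meets `z = 0` there with multiplicity three. -/
theorem cubic_tangent_of_card {K : Type*} [Field K] [Fintype K] [DecidableEq K] (c : Fin 10 → K)
    (h0 : c 0 = 0)
    (hline : ∀ l, ¬(c 1 * l + c 2 = 0 ∧ c 3 * l ^ 2 + c 4 * l + c 5 = 0 ∧
      c 6 * l ^ 3 + c 7 * l ^ 2 + c 8 * l + c 9 = 0))
    (hcard : 2 * Fintype.card K ≤ (Finset.univ.filter fun q : K × K =>
      eval ![q.1, q.2, 1] (ternaryCubic c) = 0).card)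
    (hmeet : ∀ m, eval ![m, 1, 0] (ternaryCubic c) ≠ 0) :
    c 1 = 0 ∧ c 3 = 0 ∧ c 6 ≠ 0 := by
  have hc1 : c 1 = 0 := by
    by_contra hc1
    refine hcard.not_gt ?_
    rw [Finset.card_eq_sum_card_fiberwise (f := Prod.snd) (t := Finset.univ) (by simp)]
    calc _ ≤ ∑ l : K, (if c 1 * l + c 2 = 0 then 1 else 2) := Finset.sum_le_sum fun l _ => by
          refine le_trans (Finset.card_le_card_of_injOn Prod.fst ?_ ?_)
            (card_quadratic_zeros_le (hline l))
          · rintro ⟨m, l'⟩ hq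
            simp only [Finset.coe_filter, Finset.mem_filter, Finset.mem_univ, true_and,
              Set.mem_ofPred_eq, eval_ternaryCubic, Matrix.cons_val] at hq ⊢
            obtain ⟨hq, rfl⟩ := hq
            linear_combination hq - m ^ 3 * h0
          · rintro ⟨m, l₁⟩ h₁ ⟨m', l₂⟩ h₂ h
            simp_all
      _ < ∑ l : K, 2 := Finset.sum_lt_sum (fun l _ => by split_ifs <;> simp)
          ⟨-c 2 / c 1, Finset.mem_univ _, by
            rw [if_pos (by field_simp; ring)]; simp⟩
      _ = 2 * Fintype.card K := by simp [mul_comm]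
  have hc3 : c 3 = 0 := by
    by_contra hc3
    refine hmeet (-c 6 / c 3) ?_
    simp only [eval_ternaryCubic, Matrix.cons_val, h0, hc1]
    field_simp
    ring
  refine ⟨hc1, hc3, fun hc6 => hmeet 0 ?_⟩
  simp [eval_ternaryCubic, hc6]

theorem IsNonsingularCubic.exists_pderiv_linearSubst_ne_zero
    {f : MvPolynomial (Fin 3) (GaloisField 2 2)} (hf : IsNonsingularCubic f)
    {N : Matrix (Fin 3) (Fin 3) (GaloisField 2 2)} (hN : N.det ≠ 0)
    {v : Fin 3 → AlgebraicClosure (GaloisField 2 2)} (hv : v ≠ 0)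
    (h0 : eval v (MvPolynomial.map (algebraMap _ _) (linearSubst N f)) = 0) :
    ∃ i, eval v (pderiv i (MvPolynomial.map (algebraMap _ _) (linearSubst N f))) ≠ 0 := by
  set φ := algebraMap (GaloisField 2 2) (AlgebraicClosure (GaloisField 2 2))
  have hdet : (N.map φ).det ≠ 0 := by
    rwa [← RingHom.mapMatrix_apply, ← RingHom.map_det, map_ne_zero]
  rw [map_linearSubst] at h0 ⊢
  rw [eval_linearSubst] at h0
  obtain ⟨i, hi⟩ := hf _ (fun h => hv (Matrix.eq_zero_of_vecMul_eq_zero hdet h)) h0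
  by_contra! hall
  refine hi (congrFun (Matrix.eq_zero_of_mulVec_eq_zero hdet (v := fun i =>
    eval (Matrix.vecMul v (N.map φ)) (pderiv i (MvPolynomial.map φ f))) ?_) i)
  ext j
  have h := hall j
  rw [eval_pderiv_linearSubst] at h
  simpa [Matrix.mulVec, dotProduct] using h

theorem MvPolynomial.IsHomogeneous.eval_smul_eq {R σ : Type*} [CommSemiring R] [Finite σ] {n : ℕ}
    {f : MvPolynomial σ R} (hf : f.IsHomogeneous n) (r : R) (v : σ → R) :
    eval (r • v) f = r ^ n * eval v f := by
  have := Fintype.ofFinite σ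
  rw [eval_eq', eval_eq', Finset.mul_sum]
  refine Finset.sum_congr rfl fun d hd => ?_
  have hdeg : ∑ i, d i = n := by
    rw [← hf (mem_support_iff.mp hd), Finsupp.weight_apply, Finsupp.sum_fintype _ _ (by simp)]
    simp
  simp only [Pi.smul_apply, smul_eq_mul, mul_pow, Finset.prod_mul_distrib,
    Finset.prod_pow_eq_pow_sum, hdeg]
  ring

theorem MvPolynomial.IsHomogeneous.eval_rep_mk_eq_zero_iff {K σ : Type*} [Field K] [Finite σ]
    {n : ℕ} {f : MvPolynomial σ K} (hf : f.IsHomogeneous n) (v : σ → K) (hv : v ≠ 0) :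
    eval (Projectivization.mk K v hv).rep f = 0 ↔ eval v f = 0 := by
  obtain ⟨a, ha⟩ := Projectivization.exists_smul_eq_mk_rep K v hv
  rw [← ha, Units.smul_def, hf.eval_smul_eq]
  simp

theorem Submodule.rep_mk_mem_iff {K V : Type*} [Field K] [AddCommGroup V] [Module K V]
    (S : Submodule K V) (v : V) (hv : v ≠ 0) :
    (Projectivization.mk K v hv).rep ∈ S ↔ v ∈ S := by
  obtain ⟨a, ha⟩ := Projectivization.exists_smul_eq_mk_rep K v hv
  rw [← ha, Units.smul_def, S.smul_mem_iff a.ne_zero]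

/-- If a line `ℓ₀` (spanned by `u, w`, parametrized by `(s:t) ↦ s·u + t·w`) meets the set of
rational points of a nonsingular cubic `C` over `F₄` with `9` points in exactly one point
`P = (s₀:t₀)`, then `ℓ₀.C = 3P`: the binary cubic `f|ℓ₀` is a nonzero scalar times the cube of
the linear form vanishing at `P`. In particular `P` is a flex and `ℓ₀` is the tangent at `P`. -/
theorem stmt_13 (f : MvPolynomial (Fin 3) (GaloisField 2 2))
    (hhom : f.IsHomogeneous 3) (hns : IsNonsingularCubic f)
    (h9 : {P : Projectivization (GaloisField 2 2) (Fin 3 → GaloisField 2 2) |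
      eval P.rep f = 0}.ncard = 9)
    (u w : Fin 3 → GaloisField 2 2) (hindep : LinearIndependent (GaloisField 2 2) ![u, w])
    (s₀ t₀ : GaloisField 2 2) (hv₀ : s₀ • u + t₀ • w ≠ 0)
    (hmeet : {P : Projectivization (GaloisField 2 2) (Fin 3 → GaloisField 2 2) |
        P.rep ∈ Submodule.span (GaloisField 2 2) {u, w} ∧ eval P.rep f = 0} =
      {Projectivization.mk (GaloisField 2 2) (s₀ • u + t₀ • w) hv₀}) :
    ∃ c : GaloisField 2 2, c ≠ 0 ∧
      lineRestrict f u w = C c * (C t₀ * X 0 - C s₀ * X 1) ^ 3 := by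
  classical
  have := Fintype.ofFinite (GaloisField 2 2)
  have hq : Fintype.card (GaloisField 2 2) = 4 := by
    rw [← Nat.card_eq_fintype_card, GaloisField.card 2 2 two_ne_zero]; norm_num
  obtain ⟨s₁, t₁, hst⟩ : ∃ s₁ t₁, s₀ * t₁ - t₀ * s₁ = 1 := by
    by_cases hs : s₀ = 0
    · have ht : t₀ ≠ 0 := by rintro rfl; simp [hs] at hv₀
      exact ⟨-t₀⁻¹, 0, by simp [ht]⟩
    · exact ⟨0, s₀⁻¹, by simp [hs]⟩
  obtain ⟨b, hb⟩ := exists_linearIndependent_cons_of_lt_finrank hindep (by simp)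
  rw [Fintype.linearIndependent_iff] at hb
  set p := s₀ • u + t₀ • w with hp
  set a := s₁ • u + t₁ • w with ha
  have hpS : p ∈ Submodule.span (GaloisField 2 2) {u, w} :=
    Submodule.mem_span_pair.2 ⟨s₀, t₀, rfl⟩
  have haS : a ∈ Submodule.span (GaloisField 2 2) {u, w} :=
    Submodule.mem_span_pair.2 ⟨s₁, t₁, rfl⟩
  have hli : ∀ x y z : GaloisField 2 2, x • p + y • a + z • b = 0 → x = 0 ∧ y = 0 ∧ z = 0 := by
    intro x y z h
    have h' := hb ![z, x * s₀ + y * s₁, x * t₀ + y * t₁] (by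
      rw [← h, hp, ha]
      simp [Fin.sum_univ_three]
      module)
    have hz := h' 0
    have hx := h' 1
    have hy := h' 2
    simp only [Matrix.cons_val] at hx hy hz
    exact ⟨by linear_combination t₁ * hx - s₁ * hy - x * hst,
      by linear_combination s₀ * hy - t₀ * hx - y * hst, hz⟩
  set N : Matrix (Fin 3) (Fin 3) (GaloisField 2 2) := ![p, a, b] with hN
  have hNsum (x : Fin 3 → GaloisField 2 2) : Matrix.vecMul x N = x 0 • p + x 1 • a + x 2 • b := by
    ext i
    simp [Matrix.vecMul, dotProduct, Fin.sum_univ_three, hN]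
  have hNli : LinearIndependent (GaloisField 2 2) N := by
    rw [Fintype.linearIndependent_iff]
    intro x hx i
    rw [Fin.sum_univ_three] at hx
    obtain ⟨h0, h1, h2⟩ := hli _ _ _ hx
    fin_cases i <;> assumption
  have hdet : N.det ≠ 0 :=
    ((Matrix.isUnit_iff_isUnit_det N).1 (Matrix.linearIndependent_rows_iff_isUnit.1 hNli)).ne_zero
  have hspan (v : Fin 3 → GaloisField 2 2) :
      ∃ x y z : GaloisField 2 2, v = x • p + y • a + z • b := by
    have hu := (Matrix.isUnit_iff_isUnit_det N).2 hdet.isUnit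
    obtain ⟨x, hx⟩ := (Matrix.vecMul_surjective_iff_isUnit.2 hu) v
    exact ⟨x 0, x 1, x 2, by rw [← hNsum, ← hx]⟩
  obtain ⟨c, hc⟩ := (hhom.linearSubst N).exists_eq_ternaryCubic
  have heval (x y z : GaloisField 2 2) : eval ![x, y, z] (ternaryCubic c) =
      eval (x • p + y • a + z • b) f := by
    rw [← hc, eval_linearSubst, hNsum]
    simp
  have hpf : eval p f = 0 := by
    have h := (Set.ext_iff.1 hmeet (Projectivization.mk _ p hv₀)).2 rfl
    exact (hhom.eval_rep_mk_eq_zero_iff p hv₀).1 h.2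
  have hc0 : c 0 = 0 := by
    have h := heval 1 0 0
    simpa [hpf, eval_ternaryCubic] using h
  have honly (v : Fin 3 → GaloisField 2 2) (hv : v ≠ 0)
      (hvS : v ∈ Submodule.span (GaloisField 2 2) {u, w})
      (hvf : eval v f = 0) : Projectivization.mk _ v hv = Projectivization.mk _ p hv₀ :=
    (Set.ext_iff.1 hmeet _).1 ⟨(Submodule.rep_mk_mem_iff _ v hv).2 hvS,
      (hhom.eval_rep_mk_eq_zero_iff v hv).2 hvf⟩
  obtain ⟨hc1, hc3, hc6⟩ := cubic_tangent_of_card c hc0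
    (by
      rintro l ⟨h1, h2, h3⟩
      set φ := algebraMap (GaloisField 2 2) (AlgebraicClosure (GaloisField 2 2)) with hφ
      obtain ⟨v, hv, hv0, hvd⟩ := exists_singular_ternaryCubic (φ ∘ c) (φ l) (by simp [hc0])
        (by simpa using congrArg φ h1) (by simpa using congrArg φ h2)
        (by simpa using congrArg φ h3)
      rw [← map_ternaryCubic, ← hc] at hv0 hvd
      obtain ⟨i, hi⟩ := hns.exists_pderiv_linearSubst_ne_zero hdet hv hv0
      exact hi (hvd i))
    (by
      set Z := Finset.univ.filter fun q : GaloisField 2 2 × GaloisField 2 2 =>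
        eval ![q.1, q.2, 1] (ternaryCubic c) = 0 with hZ
      have hne (q : GaloisField 2 2 × GaloisField 2 2) : q.1 • p + q.2 • a + b ≠ 0 := fun h =>
        one_ne_zero (hli q.1 q.2 1 (by rwa [one_smul])).2.2
      have hsub : {P : Projectivization (GaloisField 2 2) (Fin 3 → GaloisField 2 2) |
          eval P.rep f = 0} ⊆ insert (Projectivization.mk _ p hv₀)
            ((fun q => Projectivization.mk (GaloisField 2 2) _ (hne q)) '' (Z : Set _)) := by
        intro P hP
        obtain ⟨x, y, z, hxyz⟩ := hspan P.rep
        by_cases hz : z = 0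
        · left
          rw [← P.mk_rep]
          refine honly _ _ ?_ hP
          rw [hxyz, hz, zero_smul, add_zero]
          exact add_mem (Submodule.smul_mem _ _ hpS) (Submodule.smul_mem _ _ haS)
        · right
          have hsm : P.rep = z • ((z⁻¹ * x) • p + (z⁻¹ * y) • a + b) := by
            rw [hxyz]
            simp [smul_smul, hz]
          refine ⟨(z⁻¹ * x, z⁻¹ * y), ?_, ?_⟩
          · have hP' : eval P.rep f = 0 := hP
            rw [hsm, hhom.eval_smul_eq] at hP'
            simpa [hZ, heval, hz] using hP'
          · conv_rhs => rw [← P.mk_rep]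
            rw [Eq.comm, Projectivization.mk_eq_mk_iff']
            exact ⟨z, hsm.symm⟩
      have h := Set.ncard_le_ncard hsub (Set.toFinite _)
      have h' := Set.ncard_insert_le (Projectivization.mk _ p hv₀)
        ((fun q => Projectivization.mk (GaloisField 2 2) _ (hne q)) '' (Z : Set _))
      have h'' := Set.ncard_image_le (f := fun q => Projectivization.mk (GaloisField 2 2) _ (hne q))
        (Z.finite_toSet)
      rw [Set.ncard_coe_finset] at h''
      rw [h9] at h
      omega)
    (by
      intro m h
      rw [heval] at h
      simp only [one_smul, zero_smul, add_zero] at h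
      have hma : m • p + a ≠ 0 := fun h' =>
        one_ne_zero (hli m 1 0 (by simpa using h')).2.1
      have hmk := honly _ hma (add_mem (Submodule.smul_mem _ _ hpS) haS) h
      rw [Projectivization.mk_eq_mk_iff'] at hmk
      obtain ⟨r, hr⟩ := hmk
      refine one_ne_zero (hli (m - r) 1 0 ?_).2.1
      rw [sub_smul, hr]
      module)
  have hC : (C s₀ * C t₁ - C t₀ * C s₁ : MvPolynomial (Fin 2) (GaloisField 2 2)) = 1 := by
    rw [← C_mul, ← C_mul, ← C_sub, hst, C_1]
  have hrestrict : lineRestrict f u w =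
      aeval ![C t₁ * X 0 - C s₁ * X 1, C s₀ * X 1 - C t₀ * X 0, 0] (ternaryCubic c) := by
    rw [← hc, linearSubst, aeval_bind₁, lineRestrict]
    congr 2
    ext1 i
    simp only [Fin.sum_univ_three, map_add, map_mul, aeval_C, aeval_X, algebraMap_eq, hN, hp, ha,
      Matrix.cons_val, Pi.add_apply, Pi.smul_apply, smul_eq_mul]
    linear_combination -(C (u i) * X 0 + C (w i) * X 1) * hC
  refine ⟨-c 6, neg_ne_zero.2 hc6, ?_⟩
  rw [hrestrict]
  simp only [ternaryCubic, hc0, hc1, hc3, map_add, map_mul, map_pow, map_neg, map_zero, aeval_C,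
    aeval_X, algebraMap_eq, Matrix.cons_val]
  ring
end

section
/- Every nonsingular plane cubic curve C over F_4 with exactly 9 F_4-points is either projectively equivalent over F_4 to the Hermitian curve x₀³ + x₁³ + x₂³ = 0 or projectively equivalent over F_4 to the curve x₀³ + ω x₁³ + ω² x₂³ = 0, where ω is a generator of F_4*; and these two curves are not projectively equivalent over F_4. -/
open MvPolynomial

/-- Projective equivalence over `F₄` of the plane curves `f = 0` and `g = 0`: some element of
`PGL₃(F₄)` carries one to the other, i.e. substituting a linear change of coordinates into `f`
yields `g` up to a nonzero scalar. -/
def ProjectivelyEquivalent (f g : MvPolynomial (Fin 3) (GaloisField 2 2)) : Prop :=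
  ∃ M : GL (Fin 3) (GaloisField 2 2), ∃ c : GaloisField 2 2, c ≠ 0 ∧
    aeval (fun i => ∑ j, C ((M : Matrix (Fin 3) (Fin 3) (GaloisField 2 2)) i j) * X j) f = c • g

/-- The field with four elements. -/
abbrev F₄ := GaloisField 2 2

namespace TernaryCubic

section Substitution

variable {R : Type*} [CommRing R]

/-- The linear change of coordinates `x ↦ M x` applied to a ternary polynomial. -/
noncomputable def subst (M : Matrix (Fin 3) (Fin 3) R) :
    MvPolynomial (Fin 3) R →ₐ[R] MvPolynomial (Fin 3) R :=
  aeval fun i => ∑ j, C (M i j) * X j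

theorem subst_X (M : Matrix (Fin 3) (Fin 3) R) (i : Fin 3) :
    subst M (X i) = C (M i 0) * X 0 + C (M i 1) * X 1 + C (M i 2) * X 2 := by
  simp [subst, Fin.sum_univ_three]

theorem subst_C (M : Matrix (Fin 3) (Fin 3) R) (a : R) : subst M (C a) = C a := by
  simp [subst]

theorem eval_subst (M : Matrix (Fin 3) (Fin 3) R) (f : MvPolynomial (Fin 3) R) (v : Fin 3 → R) :
    eval v (subst M f) = eval (M.mulVec v) f := by
  induction f using MvPolynomial.induction_on with
  | C a => simp [subst]
  | add p q hp hq => simp only [map_add, hp, hq]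
  | mul_X p i hp =>
    rw [map_mul, map_mul, map_mul, hp, subst_X]
    simp [Matrix.mulVec, dotProduct, Fin.sum_univ_three]

theorem subst_subst (M N : Matrix (Fin 3) (Fin 3) R) (f : MvPolynomial (Fin 3) R) :
    subst N (subst M f) = subst (M * N) f := by
  induction f using MvPolynomial.induction_on with
  | C a => simp [subst]
  | add p q hp hq => simp only [map_add, hp, hq]
  | mul_X p i hp =>
    rw [map_mul, map_mul, map_mul, hp]
    simp only [subst_X, subst_C, map_add, map_mul, Matrix.mul_apply, Fin.sum_univ_three]
    ring

theorem pderiv_subst (M : Matrix (Fin 3) (Fin 3) R) (f : MvPolynomial (Fin 3) R) (j : Fin 3) :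
    pderiv j (subst M f) = ∑ i, C (M i j) * subst M (pderiv i f) := by
  induction f using MvPolynomial.induction_on with
  | C a => simp [subst]
  | add p q hp hq => simp only [map_add, hp, hq, mul_add, Finset.sum_add_distrib]
  | mul_X p k hp =>
    have hX : pderiv j (subst M (X k)) = C (M k j) := by
      simp [subst, pderiv_X, Pi.single_apply]
    simp only [map_mul, Derivation.leibniz, map_add, smul_eq_mul, hX, hp, pderiv_X]
    simp only [Pi.single_apply, Fin.sum_univ_three]
    fin_cases k <;> simp <;> ring

theorem isHomogeneous_subst {f : MvPolynomial (Fin 3) R} {n : ℕ} (hf : f.IsHomogeneous n)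
    (M : Matrix (Fin 3) (Fin 3) R) : (subst M f).IsHomogeneous n := by
  have := hf.aeval (n := 1) (fun i => ∑ j, C (M i j) * X j) fun i =>
    IsHomogeneous.sum _ _ _ fun j _ => by
      simpa using (isHomogeneous_C _ _).mul (isHomogeneous_X R j)
  rwa [one_mul] at this

end Substitution

/-- The ternary cubic form with the given coefficients of
`x³, x²y, x²z, xy², xyz, xz², y³, y²z, yz², z³`. -/
noncomputable def cubic {R : Type*} [CommRing R] (a b c d e f g h i j : R) :
    MvPolynomial (Fin 3) R :=
  C a * X 0 ^ 3 + C b * X 0 ^ 2 * X 1 + C c * X 0 ^ 2 * X 2 + C d * X 0 * X 1 ^ 2 +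
    C e * X 0 * X 1 * X 2 + C f * X 0 * X 2 ^ 2 + C g * X 1 ^ 3 + C h * X 1 ^ 2 * X 2 +
    C i * X 1 * X 2 ^ 2 + C j * X 2 ^ 3

theorem exists_eq_cubic {R : Type*} [CommRing R] {p : MvPolynomial (Fin 3) R}
    (hp : p.IsHomogeneous 3) :
    ∃ a b c d e f g h i j : R, p = cubic a b c d e f g h i j := by
  rw [p.as_sum]
  refine Finset.sum_induction _
    (fun q => ∃ a b c d e f g h i j : R, q = cubic a b c d e f g h i j) ?_ ?_ ?_
  · rintro _ _ ⟨a, b, c, d, e, f, g, h, i, j, rfl⟩ ⟨a', b', c', d', e', f', g', h', i', j', rfl⟩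
    refine ⟨a + a', b + b', c + c', d + d', e + e', f + f', g + g', h + h', i + i', j + j', ?_⟩
    simp only [cubic, C_add]
    ring
  · exact ⟨0, 0, 0, 0, 0, 0, 0, 0, 0, 0, by simp [cubic]⟩
  · intro m hm
    have hdeg : m 0 + m 1 + m 2 = 3 := by
      have := hp (mem_support_iff.mp hm)
      simpa [Finsupp.weight_apply, Finsupp.sum_fintype, Fin.sum_univ_three] using this
    have hmon : ∀ r : R, monomial m r = C r * X 0 ^ m 0 * X 1 ^ m 1 * X 2 ^ m 2 := fun r => by
      rw [monomial_eq, Finsupp.prod_fintype _ _ (by simp), Fin.prod_univ_three]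
      ring
    rw [hmon]
    generalize coeff m p = r
    have h0 : m 0 ≤ 3 := by omega
    have h1 : m 1 ≤ 3 := by omega
    have h2 : m 2 = 3 - m 0 - m 1 := by omega
    rw [h2]
    generalize m 0 = k at *
    generalize m 1 = l at *
    interval_cases k <;> interval_cases l <;> try omega
    · exact ⟨0, 0, 0, 0, 0, 0, 0, 0, 0, r, by simp [cubic]⟩
    · exact ⟨0, 0, 0, 0, 0, 0, 0, 0, r, 0, by simp [cubic]⟩
    · exact ⟨0, 0, 0, 0, 0, 0, 0, r, 0, 0, by simp [cubic]⟩
    · exact ⟨0, 0, 0, 0, 0, 0, r, 0, 0, 0, by simp [cubic]⟩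
    · exact ⟨0, 0, 0, 0, 0, r, 0, 0, 0, 0, by simp [cubic]⟩
    · exact ⟨0, 0, 0, 0, r, 0, 0, 0, 0, 0, by simp [cubic]⟩
    · exact ⟨0, 0, 0, r, 0, 0, 0, 0, 0, 0, by simp [cubic]⟩
    · exact ⟨0, 0, r, 0, 0, 0, 0, 0, 0, 0, by simp [cubic]⟩
    · exact ⟨0, r, 0, 0, 0, 0, 0, 0, 0, 0, by simp [cubic]⟩
    · exact ⟨r, 0, 0, 0, 0, 0, 0, 0, 0, 0, by simp [cubic]⟩

section Equivalence

theorem equivalent_of_subst {f g : MvPolynomial (Fin 3) F₄} (M : Matrix (Fin 3) (Fin 3) F₄)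
    (hM : M.det ≠ 0) {c : F₄} (hc : c ≠ 0) (h : subst M f = C c * g) :
    ProjectivelyEquivalent f g :=
  ⟨Matrix.GeneralLinearGroup.mkOfDetNeZero M hM, c, hc, by rw [smul_eq_C_mul]; exact h⟩

theorem exists_subst_of_equivalent {f g : MvPolynomial (Fin 3) F₄}
    (h : ProjectivelyEquivalent f g) :
    ∃ M : GL (Fin 3) F₄, ∃ c : F₄, c ≠ 0 ∧
      subst (M : Matrix (Fin 3) (Fin 3) F₄) f = C c * g := by
  obtain ⟨M, c, hc, h⟩ := h
  exact ⟨M, c, hc, by rw [← smul_eq_C_mul]; exact h⟩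

theorem equivalent_trans {f g h : MvPolynomial (Fin 3) F₄} (hfg : ProjectivelyEquivalent f g)
    (hgh : ProjectivelyEquivalent g h) : ProjectivelyEquivalent f h := by
  obtain ⟨M, c, hc, h₁⟩ := exists_subst_of_equivalent hfg
  obtain ⟨N, d, hd, h₂⟩ := exists_subst_of_equivalent hgh
  refine equivalent_of_subst (M * N : GL (Fin 3) F₄) (M * N).det_ne_zero (mul_ne_zero hc hd) ?_
  rw [Units.val_mul, ← subst_subst, h₁, map_mul, subst_C, h₂, C_mul, mul_assoc]

/-- The polynomial `f` has exactly `28` zeros in `F₄³`, counting the origin, and all of them other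
than the origin are nonsingular. -/
structure IsGood (f : MvPolynomial (Fin 3) F₄) : Prop where
  exists_pderiv_ne_zero : ∀ v : Fin 3 → F₄, v ≠ 0 → eval v f = 0 → ∃ i, eval v (pderiv i f) ≠ 0
  ncard_zeros : {v : Fin 3 → F₄ | eval v f = 0}.ncard = 28

theorem IsGood.of_equivalent {f g : MvPolynomial (Fin 3) F₄} (hf : IsGood f)
    (h : ProjectivelyEquivalent f g) : IsGood g := by
  obtain ⟨M, c, hc, h⟩ := exists_subst_of_equivalent h
  have hinj : Function.Injective (M : Matrix (Fin 3) (Fin 3) F₄).mulVec :=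
    Matrix.mulVec_injective_of_isUnit M.isUnit
  have heval (v : Fin 3 → F₄) :
      eval ((M : Matrix (Fin 3) (Fin 3) F₄).mulVec v) f = c * eval v g := by
    rw [← eval_subst, h, map_mul, eval_C]
  refine ⟨fun v hv hvg => ?_, ?_⟩
  · have hv' : (M : Matrix (Fin 3) (Fin 3) F₄).mulVec v ≠ 0 := fun h0 =>
      hv (hinj (by rw [h0, Matrix.mulVec_zero]))
    obtain ⟨i, hi⟩ := hf.exists_pderiv_ne_zero _ hv' (by rw [heval, hvg, mul_zero])
    by_contra! hall
    let u : Fin 3 → F₄ := fun k => eval ((M : Matrix (Fin 3) (Fin 3) F₄).mulVec v) (pderiv k f)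
    have hu : u = 0 := Matrix.vecMul_injective_of_isUnit M.isUnit ?_
    · exact hi (congrFun hu i)
    ext j
    have := congrArg (eval v) (pderiv_subst (M : Matrix (Fin 3) (Fin 3) F₄) f j)
    rw [h, pderiv_C_mul, map_mul, hall, mul_zero, map_sum] at this
    simp only [map_mul, eval_C, eval_subst] at this
    refine Eq.trans ?_ (congrFun (Matrix.zero_vecMul _) j).symm
    exact (Finset.sum_congr rfl fun _ _ => mul_comm _ _).trans this.symm
  · rw [← hf.ncard_zeros, ← Set.ncard_image_of_injective _ hinj]
    congr 1
    ext w
    simp only [Set.mem_image, Set.mem_ofPred_eq]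
    constructor
    · rintro ⟨v, hv, rfl⟩
      rw [heval, hv, mul_zero]
    · intro hw
      obtain ⟨v, rfl⟩ := Matrix.mulVec_surjective_iff_isUnit.mpr M.isUnit w
      exact ⟨v, (mul_eq_zero.mp (heval v ▸ hw)).resolve_left hc, rfl⟩

theorem natCard_F₄ : Nat.card F₄ = 4 := GaloisField.card 2 2 two_ne_zero

theorem isGood_of_ncard_eq_nine {f : MvPolynomial (Fin 3) F₄} (hhom : f.IsHomogeneous 3)
    (hns : IsNonsingularCubic f)
    (h9 : {P : Projectivization F₄ (Fin 3 → F₄) | eval P.rep f = 0}.ncard = 9) : IsGood f := by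
  have hsmul (u : F₄) (v : Fin 3 → F₄) : eval (u • v) f = u ^ 3 * eval v f := by
    obtain ⟨a, b, c, d, e, p, g, h, i, j, rfl⟩ := exists_eq_cubic hhom
    simp [cubic]
    ring
  refine ⟨fun v hv hvf => ?_, ?_⟩
  · let φ := algebraMap F₄ (AlgebraicClosure F₄)
    have hmap (p : MvPolynomial (Fin 3) F₄) : eval (φ ∘ v) (map φ p) = φ (eval v p) := by
      rw [eval_map, eval₂_comp]
    have hv' : φ ∘ v ≠ 0 := fun h0 => hv (funext fun i => φ.injective (by
      simpa using congrFun h0 i))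
    obtain ⟨i, hi⟩ := hns (φ ∘ v) hv' (by rw [hmap, hvf, map_zero])
    refine ⟨i, fun h0 => hi ?_⟩
    rw [pderiv_map, hmap, h0, map_zero]
  · have himage : {v : Fin 3 → F₄ | eval v f = 0} \ {0} =
        (fun x : Projectivization F₄ (Fin 3 → F₄) × F₄ˣ => x.2 • x.1.rep) ''
          ({P | eval P.rep f = 0} ×ˢ Set.univ) := by
      ext v
      simp only [Set.mem_sdiff, Set.mem_ofPred_eq, Set.mem_singleton_iff, Set.mem_image,
        Set.mem_prod, Set.mem_univ, and_true, Prod.exists]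
      constructor
      · rintro ⟨hvf, hv⟩
        obtain ⟨u, hu⟩ := Projectivization.exists_smul_eq_mk_rep F₄ v hv
        refine ⟨_, u⁻¹, ?_, by rw [← hu, inv_smul_smul]⟩
        rw [← hu, Units.smul_def, hsmul, hvf, mul_zero]
      · rintro ⟨P, u, hP, rfl⟩
        exact ⟨by rw [Units.smul_def, hsmul, hP, mul_zero],
          (smul_ne_zero_iff_ne u).mpr P.rep_nonzero⟩
    have hinj : Function.Injective
        (fun x : Projectivization F₄ (Fin 3 → F₄) × F₄ˣ => x.2 • x.1.rep) := by
      rintro ⟨P, u⟩ ⟨Q, w⟩ (h : u • P.rep = w • Q.rep)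
      obtain rfl : P = Q := by
        rw [← P.mk_rep, ← Q.mk_rep, Projectivization.mk_eq_mk_iff]
        exact ⟨u⁻¹ * w, by rw [mul_smul, ← h, inv_smul_smul]⟩
      refine Prod.ext rfl (Units.ext (smul_left_injective F₄ P.rep_nonzero ?_))
      exact h
    have hunits : Nat.card F₄ˣ = 3 := by
      rw [Nat.card_units, natCard_F₄]
    have h27 : ({v : Fin 3 → F₄ | eval v f = 0} \ {0}).ncard = 27 := by
      rw [himage, Set.ncard_image_of_injective _ hinj, Set.ncard_prod, h9, Set.ncard_univ, hunits]
    have h0 : (0 : Fin 3 → F₄) ∈ {v : Fin 3 → F₄ | eval v f = 0} := by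
      simpa using hsmul 0 0
    rw [← Set.ncard_sdiff_singleton_add_one h0, h27]

end Equivalence

section PointCount

/-- An element of the field with four elements, given by its coordinates in the basis `1, ω`. -/
abbrev Quad := Bool × Bool

namespace Quad

/-- Addition of coordinates. -/
def add : Quad → Quad → Quad
  | (false, false), b => b
  | (true, false), (b, b') => (!b, b')
  | (false, true), (b, b') => (b, !b')
  | (true, true), (b, b') => (!b, !b')

/-- Multiplication of coordinates, according to `ω² = ω + 1`. -/
def mul : Quad → Quad → Quad
  | (false, false), _ => (false, false)
  | (true, false), b => b
  | (false, true), (false, false) => (false, false)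
  | (false, true), (true, false) => (false, true)
  | (false, true), (false, true) => (true, true)
  | (false, true), (true, true) => (true, false)
  | (true, true), (false, false) => (false, false)
  | (true, true), (true, false) => (true, true)
  | (true, true), (false, true) => (true, false)
  | (true, true), (true, true) => (false, true)

local notation:65 a:65 " ⊹ " b:66 => add a b
local notation:70 a:70 " ⋄ " b:71 => mul a b

/-- The sum of a function over all elements. -/
def sum (f : Quad → ℕ) : ℕ :=
  f (false, false) + f (true, false) + f (false, true) + f (true, true)

theorem sum_eq_finset_sum (f : Quad → ℕ) : sum f = ∑ x, f x := by
  simp [sum, Fintype.sum_prod_type]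
  ring

/-- The indicator function of zero. -/
def indicatorZero : Quad → ℕ
  | (false, false) => 1
  | (true, _) | (false, true) => 0

theorem indicatorZero_eq_ite (a : Quad) :
    indicatorZero a = if a = (false, false) then 1 else 0 := by
  revert a
  decide

/-- The number of zeros of a function of three variables. -/
def zeroCount (p : Quad → Quad → Quad → Quad) : ℕ :=
  sum fun x => sum fun y => sum fun z => indicatorZero (p x y z)

/-- The values of a cubic form with a flex at `(1 : 0 : 0)`. -/
def flexCubic (d e g h x y z : Quad) : Quad :=
  x ⋄ x ⋄ y ⊹ d ⋄ x ⋄ y ⋄ y ⊹ e ⋄ x ⋄ y ⋄ z ⊹ g ⋄ y ⋄ y ⋄ y ⊹ h ⋄ y ⋄ y ⋄ z ⊹ z ⋄ z ⋄ z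

/-- The values of a cubic form whose tangent line at `(1 : 0 : 0)` also passes through
`(0 : 0 : 1)`. -/
def nonflexCubic (d e g h x y z : Quad) : Quad :=
  x ⋄ x ⋄ y ⊹ d ⋄ x ⋄ y ⋄ y ⊹ e ⋄ x ⋄ y ⋄ z ⊹ x ⋄ z ⋄ z ⊹ g ⋄ y ⋄ y ⋄ y ⊹ h ⋄ y ⋄ y ⋄ z

/-- The values of a cubic form divisible by `y`. -/
def reducibleCubic (d e g h i x y z : Quad) : Quad :=
  y ⋄ (x ⋄ x ⊹ d ⋄ x ⋄ y ⊹ e ⋄ x ⋄ z ⊹ g ⋄ y ⋄ y ⊹ h ⋄ y ⋄ z ⊹ i ⋄ z ⋄ z)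

theorem eq_of_zeroCount_flexCubic : ∀ d e g h : Quad, zeroCount (flexCubic d e g h) = 28 →
    d = (true, false) ∧ e = (false, false) ∧ (g = (false, false) ∨ g = (true, false)) ∧
      h = (false, false) := by
  decide +kernel

theorem eq_of_zeroCount_nonflexCubic : ∀ d e g h : Quad, zeroCount (nonflexCubic d e g h) = 28 →
    e = (false, false) ∧
      (g = (false, false) ∧ h = (false, false) ∨ g = d ⋄ d ∧ h = (true, false)) := by
  decide +kernel

theorem exists_root_of_zeroCount_reducibleCubic : ∀ e i : Quad,
    (∃ x : Quad, x ⋄ x ⊹ e ⋄ x ⊹ i = (false, false)) ∨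
      ∀ d g h : Quad, zeroCount (reducibleCubic d e g h i) ≠ 28 := by
  decide +kernel

/-- The element of `F₄` with the given coordinates. -/
noncomputable def toF₄ (ω : F₄) (a : Quad) : F₄ :=
  (if a.1 then 1 else 0) + if a.2 then ω else 0

variable {ω : F₄}

theorem toF₄_false_false : toF₄ ω (false, false) = 0 := by simp [toF₄]

theorem toF₄_true_false : toF₄ ω (true, false) = 1 := by simp [toF₄]

theorem toF₄_add (a b : Quad) : toF₄ ω (a ⊹ b) = toF₄ ω a + toF₄ ω b := by
  have h2 : (2 : F₄) = 0 := CharTwo.two_eq_zero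
  obtain ⟨a, a'⟩ := a
  obtain ⟨b, b'⟩ := b
  cases a <;> cases a' <;> cases b <;> cases b' <;> simp [toF₄, add] <;> grind

theorem toF₄_mul (hω : ω ^ 2 + ω + 1 = 0) (a b : Quad) :
    toF₄ ω (a ⋄ b) = toF₄ ω a * toF₄ ω b := by
  have h2 : (2 : F₄) = 0 := CharTwo.two_eq_zero
  obtain ⟨a, a'⟩ := a
  obtain ⟨b, b'⟩ := b
  cases a <;> cases a' <;> cases b <;> cases b' <;> simp [toF₄, mul] <;> grind

theorem toF₄_eq_zero_iff (hω : ω ^ 2 + ω + 1 = 0) (a : Quad) :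
    toF₄ ω a = 0 ↔ a = (false, false) := by
  obtain ⟨a, a'⟩ := a
  cases a <;> cases a' <;> simp [toF₄] <;> grind

theorem toF₄_bijective (hω : ω ^ 2 + ω + 1 = 0) : Function.Bijective (toF₄ ω) := by
  rw [Nat.bijective_iff_injective_and_card]
  refine ⟨fun a b hab => ?_, by simp [natCard_F₄]⟩
  have h : toF₄ ω (a ⊹ b) = 0 := by rw [toF₄_add, hab, CharTwo.add_self_eq_zero]
  rw [toF₄_eq_zero_iff hω] at h
  revert h
  clear hab
  revert a b
  decide

theorem zeroCount_eq_ncard (hω : ω ^ 2 + ω + 1 = 0) {f : MvPolynomial (Fin 3) F₄}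
    {p : Quad → Quad → Quad → Quad}
    (hp : ∀ x y z, toF₄ ω (p x y z) = eval ![toF₄ ω x, toF₄ ω y, toF₄ ω z] f) :
    zeroCount p = {v : Fin 3 → F₄ | eval v f = 0}.ncard := by
  have hbij := toF₄_bijective hω
  have himage : {v : Fin 3 → F₄ | eval v f = 0} =
      (fun q : Quad × Quad × Quad => ![toF₄ ω q.1, toF₄ ω q.2.1, toF₄ ω q.2.2]) ''
        (Finset.univ.filter fun q : Quad × Quad × Quad => p q.1 q.2.1 q.2.2 = (false, false)) := by
    ext v
    simp only [Set.mem_ofPred_eq, Set.mem_image, Finset.coe_filter, Finset.mem_univ, true_and,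
      ← toF₄_eq_zero_iff hω, hp]
    constructor
    · intro hv
      obtain ⟨x, hx⟩ := hbij.2 (v 0)
      obtain ⟨y, hy⟩ := hbij.2 (v 1)
      obtain ⟨z, hz⟩ := hbij.2 (v 2)
      have hxyz : ![toF₄ ω x, toF₄ ω y, toF₄ ω z] = v := by
        ext k
        fin_cases k <;> simp [hx, hy, hz]
      exact ⟨(x, y, z), by rwa [← hxyz] at hv, hxyz⟩
    · rintro ⟨q, hq, rfl⟩
      exact hq
  rw [himage, Set.ncard_image_of_injective, Set.ncard_coe_finset, Finset.card_filter, zeroCount]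
  · simp only [sum_eq_finset_sum, indicatorZero_eq_ite, Fintype.sum_prod_type]
  · rintro ⟨x, y, z⟩ ⟨x', y', z'⟩ h
    have h0 := hbij.1 (congrFun h 0)
    have h1 := hbij.1 (congrFun h 1)
    have h2 := hbij.1 (congrFun h 2)
    simp_all

end Quad

end PointCount

section NormalForm

theorem pow_four (t : F₄) : t ^ 4 = t := by
  have := Fintype.ofFinite F₄
  simpa only [← Nat.card_eq_fintype_card, natCard_F₄] using FiniteField.pow_card t

theorem pow_three {t : F₄} (ht : t ≠ 0) : t ^ 3 = 1 := by
  have := pow_four t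
  exact mul_right_cancel₀ ht (by rw [one_mul, ← pow_succ, this])

theorem exists_equivalent_cubic_zero {f : MvPolynomial (Fin 3) F₄} (hhom : f.IsHomogeneous 3)
    (hf : IsGood f) :
    ∃ b c d e p g h i j : F₄, ProjectivelyEquivalent f (cubic 0 b c d e p g h i j) := by
  obtain ⟨v, hv, hv0⟩ := Set.exists_ne_of_one_lt_ncard (hf.ncard_zeros ▸ (by norm_num : 1 < 28)) 0
  obtain ⟨M, hM, hMv⟩ : ∃ M : Matrix (Fin 3) (Fin 3) F₄, M.det ≠ 0 ∧ M.mulVec ![1, 0, 0] = v := by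
    obtain ⟨k, hk⟩ := Function.ne_iff.mp hv0
    fin_cases k
    · exact ⟨!![v 0, 0, 0; v 1, 1, 0; v 2, 0, 1], by simpa [Matrix.det_fin_three] using hk,
        by ext l; fin_cases l <;> simp⟩
    · exact ⟨!![v 0, 1, 0; v 1, 0, 0; v 2, 0, 1], by simpa [Matrix.det_fin_three] using hk,
        by ext l; fin_cases l <;> simp⟩
    · exact ⟨!![v 0, 1, 0; v 1, 0, 1; v 2, 0, 0], by simpa [Matrix.det_fin_three] using hk,
        by ext l; fin_cases l <;> simp⟩
  obtain ⟨a, b, c, d, e, p, g, h, i, j, hcubic⟩ := exists_eq_cubic (isHomogeneous_subst hhom M)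
  have ha : a = 0 := by
    have := eval_subst M f ![1, 0, 0]
    rw [hMv, show eval v f = 0 from hv, hcubic] at this
    simpa [cubic] using this
  subst ha
  exact ⟨b, c, d, e, p, g, h, i, j, equivalent_of_subst M hM one_ne_zero (by simpa using hcubic)⟩

theorem cubic_equivalent_scale_tangent {b : F₄} (hb : b ≠ 0) (c d e p g h i j : F₄) :
    ∃ d' e' p' g' h' i' j' : F₄, ProjectivelyEquivalent (cubic 0 b c d e p g h i j)
      (cubic 0 1 0 d' e' p' g' h' i' j') := by
  obtain ⟨r, hr⟩ : ∃ r, b * r = 1 := ⟨b⁻¹, mul_inv_cancel₀ hb⟩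
  obtain ⟨s, hs⟩ : ∃ s, b * s + c = 0 := ⟨-(r * c), by linear_combination -c * hr⟩
  have hr0 : r ≠ 0 := right_ne_zero_of_mul (hr ▸ one_ne_zero)
  refine ⟨d * r ^ 2, 2 * d * r * s + e * r, d * s ^ 2 + e * s + p, g * r ^ 3,
    3 * g * r ^ 2 * s + h * r ^ 2, 3 * g * r * s ^ 2 + 2 * h * r * s + i * r,
    g * s ^ 3 + h * s ^ 2 + i * s + j,
    equivalent_of_subst !![1, 0, 0; 0, r, s; 0, 0, 1] (by simpa [Matrix.det_fin_three])
      one_ne_zero ?_⟩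
  have hr' : (C b * C r : MvPolynomial (Fin 3) F₄) = 1 := by rw [← C_mul, hr, C_1]
  have hs' : (C b * C s + C c : MvPolynomial (Fin 3) F₄) = 0 := by
    rw [← C_mul, ← C_add, hs, C_0]
  simp [cubic, subst_X, map_ofNat C]
  linear_combination X 0 ^ 2 * X 1 * hr' + X 0 ^ 2 * X 2 * hs'

theorem cubic_equivalent_swap (c d e p g h i j : F₄) :
    ProjectivelyEquivalent (cubic 0 0 c d e p g h i j) (cubic 0 c 0 p e d j i h g) := by
  refine equivalent_of_subst !![1, 0, 0; 0, 0, 1; 0, 1, 0] (by simp [Matrix.det_fin_three])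
    one_ne_zero ?_
  simp [cubic, subst_X]
  ring

theorem exists_equivalent_cubic_tangent {b c d e p g h i j : F₄}
    (hf : IsGood (cubic 0 b c d e p g h i j)) :
    ∃ d' e' p' g' h' i' j' : F₄, ProjectivelyEquivalent (cubic 0 b c d e p g h i j)
      (cubic 0 1 0 d' e' p' g' h' i' j') := by
  by_cases hb : b = 0
  · subst hb
    by_cases hc : c = 0
    · subst hc
      obtain ⟨k, hk⟩ := hf.exists_pderiv_ne_zero ![1, 0, 0] (by simp) (by simp [cubic])
      refine absurd ?_ hk
      fin_cases k <;> simp [cubic, pderiv_X]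
    · obtain ⟨d', e', p', g', h', i', j', hequiv⟩ :=
        cubic_equivalent_scale_tangent hc 0 p e d j i h g
      exact ⟨d', e', p', g', h', i', j',
        equivalent_trans (cubic_equivalent_swap c d e p g h i j) hequiv⟩
  · exact cubic_equivalent_scale_tangent hb c d e p g h i j

theorem cubic_equivalent_shift_xz (d e p g h i j t : F₄) :
    ProjectivelyEquivalent (cubic 0 1 0 d e p g h i j)
      (cubic 0 1 0 d (e + 2 * t) p g (h + t * d) (i + t * e + t ^ 2) (j + t * p)) := by
  refine equivalent_of_subst !![1, 0, t; 0, 1, 0; 0, 0, 1] (by simp [Matrix.det_fin_three])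
    one_ne_zero ?_
  simp [cubic, subst_X, map_ofNat C]
  ring

theorem cubic_equivalent_shift_xy (d e p g h i j s : F₄) :
    ProjectivelyEquivalent (cubic 0 1 0 d e p g h i j)
      (cubic 0 1 0 (d + 2 * s) e p (g + s ^ 2 + s * d) (h + s * e) (i + s * p) j) := by
  refine equivalent_of_subst !![1, s, 0; 0, 1, 0; 0, 0, 1] (by simp [Matrix.det_fin_three])
    one_ne_zero ?_
  simp [cubic, subst_X, map_ofNat C]
  ring

theorem cubic_equivalent_shift_zy (d e p g h i j t : F₄) :
    ProjectivelyEquivalent (cubic 0 1 0 d e p g h i j)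
      (cubic 0 1 0 (d + t * e + t ^ 2 * p) (e + 2 * t * p) p (g + t * h + t ^ 2 * i + t ^ 3 * j)
        (h + 2 * t * i + 3 * t ^ 2 * j) (i + 3 * t * j) j) := by
  refine equivalent_of_subst !![1, 0, 0; 0, 1, 0; 0, t, 1] (by simp [Matrix.det_fin_three])
    one_ne_zero ?_
  simp [cubic, subst_X, map_ofNat C]
  ring

theorem cubic_equivalent_scale_z (d e p g h i j : F₄) {s : F₄} (hs : s ≠ 0) :
    ProjectivelyEquivalent (cubic 0 1 0 d e p g h i j)
      (cubic 0 1 0 d (e * s) (p * s ^ 2) g (h * s) (i * s ^ 2) (j * s ^ 3)) := by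
  refine equivalent_of_subst !![1, 0, 0; 0, 1, 0; 0, 0, s] (by simpa [Matrix.det_fin_three])
    one_ne_zero ?_
  simp [cubic, subst_X]
  ring

theorem cubic_equivalent_scale_y (d e g h i j : F₄) (hj : j ≠ 0) :
    ProjectivelyEquivalent (cubic 0 1 0 d e 0 g h i j)
      (cubic 0 1 0 (d * j) e 0 (g * j ^ 2) (h * j) i 1) := by
  refine equivalent_of_subst !![1, 0, 0; 0, j, 0; 0, 0, 1] (by simpa [Matrix.det_fin_three])
    hj ?_
  simp [cubic, subst_X]
  ring

theorem cubic_equivalent_klein {d e p g h i j : F₄} (hp : p ≠ 0)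
    (hf : IsGood (cubic 0 1 0 d e p g h i j)) {ω : F₄} (hω : ω ^ 2 + ω + 1 = 0) :
    ProjectivelyEquivalent (cubic 0 1 0 d e p g h i j) (cubic 0 1 0 0 0 1 0 1 0 0) := by
  have h2 : (2 : F₄) = 0 := CharTwo.two_eq_zero
  obtain ⟨d, e, g, h, i, hequiv₁⟩ : ∃ d' e' g' h' i', ProjectivelyEquivalent
      (cubic 0 1 0 d e p g h i j) (cubic 0 1 0 d' e' p g' h' i' 0) := by
    have hequiv := cubic_equivalent_shift_xz d e p g h i j (-(j * p⁻¹))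
    rw [show j + -(j * p⁻¹) * p = 0 by field_simp; ring] at hequiv
    exact ⟨_, _, _, _, _, hequiv⟩
  obtain ⟨e, h, i, hequiv₂⟩ : ∃ e' h' i', ProjectivelyEquivalent
      (cubic 0 1 0 d e p g h i 0) (cubic 0 1 0 d e' 1 g h' i' 0) := by
    have hequiv := cubic_equivalent_scale_z d e p g h i 0 hp
    rw [zero_mul, ← pow_succ', pow_three hp] at hequiv
    exact ⟨_, _, _, hequiv⟩
  obtain ⟨d, g, h, hequiv₃⟩ : ∃ d' g' h', ProjectivelyEquivalent
      (cubic 0 1 0 d e 1 g h i 0) (cubic 0 1 0 d' e 1 g' h' 0 0) := by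
    have hequiv := cubic_equivalent_shift_xy d e 1 g h i 0 (-i)
    rw [mul_one, add_neg_cancel] at hequiv
    exact ⟨_, _, _, hequiv⟩
  have hequiv := equivalent_trans hequiv₁ (equivalent_trans hequiv₂ hequiv₃)
  refine equivalent_trans hequiv ?_
  replace hf := hf.of_equivalent hequiv
  obtain ⟨d, rfl⟩ := (Quad.toF₄_bijective hω).2 d
  obtain ⟨e, rfl⟩ := (Quad.toF₄_bijective hω).2 e
  obtain ⟨g, rfl⟩ := (Quad.toF₄_bijective hω).2 g
  obtain ⟨h, rfl⟩ := (Quad.toF₄_bijective hω).2 h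
  have hcount := Quad.zeroCount_eq_ncard hω (f := cubic 0 1 0 (Quad.toF₄ ω d) (Quad.toF₄ ω e) 1
    (Quad.toF₄ ω g) (Quad.toF₄ ω h) 0 0) (p := Quad.nonflexCubic d e g h) fun x y z => by
      simp only [Quad.nonflexCubic, Quad.toF₄_add, Quad.toF₄_mul hω]
      simp [cubic]
      ring
  rw [hf.ncard_zeros] at hcount
  obtain ⟨rfl, hgh⟩ := Quad.eq_of_zeroCount_nonflexCubic d e g h hcount
  have hequiv₄ := cubic_equivalent_shift_zy (Quad.toF₄ ω d) 0 1 (Quad.toF₄ ω g) (Quad.toF₄ ω h) 0 0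
    (Quad.toF₄ ω d ^ 2)
  have hd : Quad.toF₄ ω d + Quad.toF₄ ω d ^ 2 * 0 + (Quad.toF₄ ω d ^ 2) ^ 2 * 1 = 0 := by
    linear_combination pow_four (Quad.toF₄ ω d) + Quad.toF₄ ω d * h2
  rw [hd] at hequiv₄
  rw [Quad.toF₄_false_false] at hf ⊢
  rcases hgh with ⟨rfl, rfl⟩ | ⟨rfl, rfl⟩
  · simp only [Quad.toF₄_false_false, h2, mul_zero, zero_mul, add_zero] at hequiv₄ hf
    obtain ⟨k, hk⟩ := (hf.of_equivalent hequiv₄).exists_pderiv_ne_zero ![0, 1, 0] (by simp)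
      (by simp [cubic])
    refine absurd ?_ hk
    fin_cases k <;> simp [cubic, pderiv_X]
  · rw [Quad.toF₄_mul hω, Quad.toF₄_true_false] at hequiv₄ ⊢
    convert hequiv₄ using 2
    all_goals grind

theorem cubic_tangent_equivalent_fermat {ω : F₄} (hω : ω ^ 2 + ω + 1 = 0) :
    ProjectivelyEquivalent (cubic 0 1 0 1 0 0 0 0 0 1) (cubic 1 0 0 0 0 0 1 0 0 1) := by
  have h2' : (2 : MvPolynomial (Fin 3) F₄) = 0 := CharTwo.two_eq_zero
  have hω' : (C ω : MvPolynomial (Fin 3) F₄) ^ 2 + C ω + 1 = 0 := by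
    rw [← C_pow, ← C_add, ← C_1, ← C_add, hω, C_0]
  refine equivalent_of_subst !![1, 1, 0; ω, ω ^ 2, 0; 0, 0, 1] ?_ one_ne_zero ?_
  · simp [Matrix.det_fin_three]
    grind
  · simp [cubic, subst_X]
    linear_combination (C ω ^ 2 * X 0 * X 1 ^ 2 + C ω ^ 2 * X 1 ^ 3 + 2 * C ω * X 0 ^ 2 * X 1 +
      C ω * X 0 * X 1 ^ 2 - C ω * X 1 ^ 3 + X 0 ^ 3 + X 1 ^ 3) * hω' -
      (X 0 ^ 3 + X 1 ^ 3) * h2'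

theorem cubic_tangent_add_cube_equivalent_fermat :
    ProjectivelyEquivalent (cubic 0 1 0 1 0 0 1 0 0 1 : MvPolynomial (Fin 3) F₄)
      (cubic 1 0 0 0 0 0 1 0 0 1) := by
  have h2' : (2 : MvPolynomial (Fin 3) F₄) = 0 := CharTwo.two_eq_zero
  refine equivalent_of_subst !![0, 1, 0; 1, 1, 0; 0, 0, 1] ?_ one_ne_zero ?_
  · simp [Matrix.det_fin_three]
  · simp [cubic, subst_X]
    linear_combination (3 * X 0 * X 1 ^ 2 + X 1 ^ 3 + 2 * X 0 ^ 2 * X 1) * h2'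

theorem cubic_equivalent_fermat {d e g h i j : F₄} (hj : j ≠ 0)
    (hf : IsGood (cubic 0 1 0 d e 0 g h i j)) {ω : F₄} (hω : ω ^ 2 + ω + 1 = 0) :
    ProjectivelyEquivalent (cubic 0 1 0 d e 0 g h i j) (cubic 1 0 0 0 0 0 1 0 0 1) := by
  have h2 : (2 : F₄) = 0 := CharTwo.two_eq_zero
  obtain ⟨d, g, h, hequiv₁⟩ : ∃ d' g' h', ProjectivelyEquivalent
      (cubic 0 1 0 d e 0 g h i j) (cubic 0 1 0 d' e 0 g' h' 0 j) := by
    have hequiv := cubic_equivalent_shift_zy d e 0 g h i j (i * j⁻¹)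
    rw [show i + 3 * (i * j⁻¹) * j = 0 by field_simp; linear_combination 2 * i * h2] at hequiv
    simp only [mul_zero, add_zero] at hequiv
    exact ⟨_, _, _, hequiv⟩
  have hequiv := equivalent_trans hequiv₁ (cubic_equivalent_scale_y d e g h 0 j hj)
  generalize d * j = d at hequiv
  generalize g * j ^ 2 = g at hequiv
  generalize h * j = h at hequiv
  refine equivalent_trans hequiv ?_
  replace hf := hf.of_equivalent hequiv
  obtain ⟨d, rfl⟩ := (Quad.toF₄_bijective hω).2 d
  obtain ⟨e, rfl⟩ := (Quad.toF₄_bijective hω).2 e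
  obtain ⟨g, rfl⟩ := (Quad.toF₄_bijective hω).2 g
  obtain ⟨h, rfl⟩ := (Quad.toF₄_bijective hω).2 h
  have hcount := Quad.zeroCount_eq_ncard hω (f := cubic 0 1 0 (Quad.toF₄ ω d) (Quad.toF₄ ω e) 0
    (Quad.toF₄ ω g) (Quad.toF₄ ω h) 0 1) (p := Quad.flexCubic d e g h) fun x y z => by
      simp only [Quad.flexCubic, Quad.toF₄_add, Quad.toF₄_mul hω]
      simp [cubic]
      ring
  rw [hf.ncard_zeros] at hcount
  obtain ⟨rfl, rfl, rfl | rfl, rfl⟩ := Quad.eq_of_zeroCount_flexCubic d e g h hcount <;>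
    simp only [Quad.toF₄_false_false, Quad.toF₄_true_false]
  · exact cubic_tangent_equivalent_fermat hω
  · exact cubic_tangent_add_cube_equivalent_fermat

theorem not_isGood_cubic_of_line {d e g h i : F₄} {ω : F₄} (hω : ω ^ 2 + ω + 1 = 0) :
    ¬ IsGood (cubic 0 1 0 d e 0 g h i 0) := by
  intro hf
  obtain ⟨d, rfl⟩ := (Quad.toF₄_bijective hω).2 d
  obtain ⟨e, rfl⟩ := (Quad.toF₄_bijective hω).2 e
  obtain ⟨g, rfl⟩ := (Quad.toF₄_bijective hω).2 g
  obtain ⟨h, rfl⟩ := (Quad.toF₄_bijective hω).2 h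
  obtain ⟨i, rfl⟩ := (Quad.toF₄_bijective hω).2 i
  obtain ⟨x, hx⟩ | hcount := Quad.exists_root_of_zeroCount_reducibleCubic e i
  · have hx' := congrArg (Quad.toF₄ ω) hx
    rw [Quad.toF₄_add, Quad.toF₄_add, Quad.toF₄_mul hω, Quad.toF₄_mul hω,
      Quad.toF₄_false_false] at hx'
    obtain ⟨k, hk⟩ := hf.exists_pderiv_ne_zero ![Quad.toF₄ ω x, 0, 1] (by simp) (by simp [cubic])
    refine absurd ?_ hk
    fin_cases k <;> simp [cubic, pderiv_X]
    linear_combination hx'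
  · refine hcount d g h ?_
    rw [← hf.ncard_zeros]
    refine Quad.zeroCount_eq_ncard hω fun x y z => ?_
    simp only [Quad.reducibleCubic, Quad.toF₄_add, Quad.toF₄_mul hω]
    simp [cubic]
    ring

theorem klein_equivalent_diagonal {ω : F₄} (hω : ω ^ 2 + ω + 1 = 0) :
    ProjectivelyEquivalent (cubic 0 1 0 0 0 1 0 1 0 0) (cubic 1 0 0 0 0 0 ω 0 0 (ω ^ 2)) := by
  have h2' : (2 : MvPolynomial (Fin 3) F₄) = 0 := CharTwo.two_eq_zero
  have hω' : (C ω : MvPolynomial (Fin 3) F₄) ^ 2 + C ω + 1 = 0 := by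
    rw [← C_pow, ← C_add, ← C_1, ← C_add, hω, C_0]
  refine equivalent_of_subst !![1, 1, 1; 1, ω, ω ^ 2; 1, ω ^ 2, ω] ?_ one_ne_zero ?_
  · simp [Matrix.det_fin_three]
    grind
  · simp [cubic, subst_X]
    linear_combination (C ω ^ 4 * X 1 * X 2 ^ 2 + 2 * C ω ^ 3 * X 1 ^ 2 * X 2 -
      C ω ^ 3 * X 1 * X 2 ^ 2 + C ω ^ 3 * X 2 ^ 3 + C ω ^ 2 * X 0 * X 1 ^ 2 +
      2 * C ω ^ 2 * X 0 * X 1 * X 2 + C ω ^ 2 * X 0 * X 2 ^ 2 + 2 * C ω ^ 2 * X 1 ^ 3 -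
      C ω ^ 2 * X 1 ^ 2 * X 2 + 2 * C ω ^ 2 * X 1 * X 2 ^ 2 - C ω ^ 2 * X 2 ^ 3 +
      C ω * X 0 * X 1 ^ 2 + 2 * C ω * X 0 * X 1 * X 2 + C ω * X 0 * X 2 ^ 2 -
      2 * C ω * X 1 ^ 3 + 2 * C ω * X 1 ^ 2 * X 2 + C ω * X 1 * X 2 ^ 2 + 3 * X 0 ^ 2 * X 1 +
      3 * X 0 ^ 2 * X 2 + X 0 * X 1 ^ 2 + 2 * X 0 * X 1 * X 2 + X 0 * X 2 ^ 2 +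
      2 * X 2 ^ 3) * hω' + (X 0 ^ 3 + C ω * X 1 ^ 3 - C ω * X 2 ^ 3 - X 2 ^ 3) * h2'

theorem equivalent_fermat_or_klein {f : MvPolynomial (Fin 3) F₄} (hhom : f.IsHomogeneous 3)
    (hf : IsGood f) {ω : F₄} (hω : ω ^ 2 + ω + 1 = 0) :
    ProjectivelyEquivalent f (cubic 1 0 0 0 0 0 1 0 0 1) ∨
      ProjectivelyEquivalent f (cubic 0 1 0 0 0 1 0 1 0 0) := by
  obtain ⟨b, c, d, e, p, g, h, i, j, hequiv₁⟩ := exists_equivalent_cubic_zero hhom hf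
  obtain ⟨d, e, p, g, h, i, j, hequiv₂⟩ :=
    exists_equivalent_cubic_tangent (hf.of_equivalent hequiv₁)
  have hequiv := equivalent_trans hequiv₁ hequiv₂
  replace hf := hf.of_equivalent hequiv
  by_cases hp : p = 0
  · subst hp
    by_cases hj : j = 0
    · subst hj
      exact absurd hf (not_isGood_cubic_of_line hω)
    · exact Or.inl (equivalent_trans hequiv (cubic_equivalent_fermat hj hf hω))
  · exact Or.inr (equivalent_trans hequiv (cubic_equivalent_klein hp hf hω))

theorem not_fermat_equivalent_diagonal {ω : F₄} (hω : ω ^ 2 + ω + 1 = 0) :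
    ¬ ProjectivelyEquivalent (cubic 1 0 0 0 0 0 1 0 0 1) (cubic 1 0 0 0 0 0 ω 0 0 (ω ^ 2)) := by
  intro hequiv
  have h2 : (2 : F₄) = 0 := CharTwo.two_eq_zero
  obtain ⟨M, c, hc, h⟩ := exists_subst_of_equivalent hequiv
  have hidem (v : Fin 3 → F₄) :
      (c * eval v (cubic 1 0 0 0 0 0 ω 0 0 (ω ^ 2))) ^ 2 =
        c * eval v (cubic 1 0 0 0 0 0 ω 0 0 (ω ^ 2)) := by
    rw [← eval_C (f := v) c, ← map_mul, ← h, eval_subst]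
    generalize (M : Matrix (Fin 3) (Fin 3) F₄).mulVec v = w
    simp only [cubic, map_add, map_mul, map_pow, eval_C, eval_X]
    linear_combination (w 0 ^ 2) * pow_four (w 0) + (w 1 ^ 2) * pow_four (w 1) +
      (w 2 ^ 2) * pow_four (w 2) +
      (w 0 ^ 3 * w 1 ^ 3 + w 0 ^ 3 * w 2 ^ 3 + w 1 ^ 3 * w 2 ^ 3) * h2
  have hc1 := hidem ![1, 0, 0]
  have hcω := hidem ![0, 1, 0]
  simp [cubic] at hc1 hcω
  grind

end NormalForm

end TernaryCubic

/-- Every nonsingular plane cubic over `F₄` with exactly nine `F₄`-points is projectively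
equivalent over `F₄` to the Hermitian curve `x₀³ + x₁³ + x₂³ = 0` or to the curve
`x₀³ + ωx₁³ + ω²x₂³ = 0` (`ω` a generator of `F₄*`), and these two are not projectively
equivalent over `F₄`. -/
theorem stmt_17 (ω : GaloisField 2 2) (hω : ω ^ 2 + ω + 1 = 0)
    (f : MvPolynomial (Fin 3) (GaloisField 2 2))
    (hhom : f.IsHomogeneous 3) (hns : IsNonsingularCubic f)
    (h9 : {P : Projectivization (GaloisField 2 2) (Fin 3 → GaloisField 2 2) |
      eval P.rep f = 0}.ncard = 9) :
    (ProjectivelyEquivalent f ((X 0 : MvPolynomial (Fin 3) (GaloisField 2 2)) ^ 3 + X 1 ^ 3 + X 2 ^ 3) ∨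
     ProjectivelyEquivalent f ((X 0 : MvPolynomial (Fin 3) (GaloisField 2 2)) ^ 3
       + C ω * X 1 ^ 3 + C (ω ^ 2) * X 2 ^ 3)) ∧
    ¬ ProjectivelyEquivalent ((X 0 : MvPolynomial (Fin 3) (GaloisField 2 2)) ^ 3 + X 1 ^ 3 + X 2 ^ 3)
      ((X 0 : MvPolynomial (Fin 3) (GaloisField 2 2)) ^ 3 + C ω * X 1 ^ 3 + C (ω ^ 2) * X 2 ^ 3) := by
  have hfermat : (X 0 : MvPolynomial (Fin 3) (GaloisField 2 2)) ^ 3 + X 1 ^ 3 + X 2 ^ 3 =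
      TernaryCubic.cubic 1 0 0 0 0 0 1 0 0 1 := by
    simp [TernaryCubic.cubic]
  have hdiagonal : (X 0 : MvPolynomial (Fin 3) (GaloisField 2 2)) ^ 3 + C ω * X 1 ^ 3 +
      C (ω ^ 2) * X 2 ^ 3 = TernaryCubic.cubic 1 0 0 0 0 0 ω 0 0 (ω ^ 2) := by
    simp [TernaryCubic.cubic]
  rw [hfermat, hdiagonal]
  refine ⟨?_, TernaryCubic.not_fermat_equivalent_diagonal hω⟩
  exact (TernaryCubic.equivalent_fermat_or_klein hhom
    (TernaryCubic.isGood_of_ncard_eq_nine hhom hns h9) hω).imp_right fun h =>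
      TernaryCubic.equivalent_trans h (TernaryCubic.klein_equivalent_diagonal hω)
end

section
/- The function field over F_4 of the Hermitian curve x₀³ + x₁³ + x₂³ = 0 is isomorphic as an F_4-algebra to the function field over F_4 of the curve x₀³ + ω x₁³ + ω² x₂³ = 0, where F_4 = F_2[ω], ω² + ω + 1 = 0. -/
open MvPolynomial

section Irreducible

variable {k : Type*} [Field k]

theorem MvPolynomial.squarefree_C_mul_X_pow_three_add_C (h3 : (3 : k) ≠ 0) {a b : k}
    (hb : b ≠ 0) : Squarefree (C a * X 0 ^ 3 + C b : MvPolynomial (Fin 1) k) := by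
  rintro q ⟨r, hr⟩
  have hder : q ∣ C (3 * a) * X 0 ^ 2 := by
    have h := congrArg (pderiv (0 : Fin 1)) hr
    simp only [map_add, Derivation.leibniz, Derivation.leibniz_pow, pderiv_C, pderiv_X_self,
      smul_eq_mul] at h
    refine ⟨q * pderiv 0 r + 2 * r * pderiv 0 q, ?_⟩
    simp only [map_mul, map_ofNat]
    simp at h
    linear_combination h
  have hconst : q ∣ C (3 * b) := by
    have h : (C (3 * b) : MvPolynomial (Fin 1) k)
        = 3 * (q * q * r) - X 0 * (C (3 * a) * X 0 ^ 2) := by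
      rw [← hr]
      simp only [map_mul, map_ofNat]
      ring
    rw [h]
    exact dvd_sub ⟨3 * (q * r), by ring⟩ (hder.mul_left _)
  exact isUnit_of_dvd_unit hconst ((mul_ne_zero h3 hb).isUnit.map C)

theorem MvPolynomial.irreducible_X_pow_three_add_C_mul_X_pow_three_add_C (h3 : (3 : k) ≠ 0)
    {a b : k} (ha : a ≠ 0) (hb : b ≠ 0) :
    Irreducible (X 0 ^ 3 + C a * X 1 ^ 3 + C b : MvPolynomial (Fin 2) k) := by
  set d : MvPolynomial (Fin 1) k := C a * X 0 ^ 3 + C b with hd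
  have hcoeff : coeff (Finsupp.single 0 3) d = a := by
    simp [hd, coeff_C_mul, coeff_X_pow, coeff_C, eq_comm (a := (0 : Fin 1 →₀ ℕ))]
  have hd0 : d ≠ 0 := fun h => ha (by rw [← hcoeff, h, coeff_zero])
  have hdu : ¬ IsUnit d := by
    intro h
    obtain ⟨c, -, hc⟩ := isUnit_iff_eq_C_of_isReduced.1 h
    apply ha
    simp [← hcoeff, hc, coeff_C, eq_comm (a := (0 : Fin 1 →₀ ℕ))]
  obtain ⟨p, hp, hpd⟩ := WfDvdMonoid.exists_irreducible_factor hdu hd0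
  have hmap : finSuccEquiv k 1 (X 0 ^ 3 + C a * X 1 ^ 3 + C b)
      = Polynomial.X ^ 3 + Polynomial.C d := by
    have h0 : finSuccEquiv k 1 (X 0) = Polynomial.X := finSuccEquiv_X_zero
    have h1 : finSuccEquiv k 1 (X 1) = Polynomial.C (X 0) := finSuccEquiv_X_succ (j := 0)
    have hC (c : k) : finSuccEquiv k 1 (C c) = Polynomial.C (C c) := by
      rw [finSuccEquiv_apply, eval₂Hom_C, RingHom.comp_apply]
    simp only [map_add, map_mul, map_pow, h0, h1, hC, hd, add_assoc]
  rw [← MulEquiv.irreducible_iff (finSuccEquiv k 1), hmap]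
  have hmonic : (Polynomial.X ^ 3 + Polynomial.C d).Monic := Polynomial.monic_X_pow_add_C d (by simp)
  have hdeg : (Polynomial.X ^ 3 + Polynomial.C d).degree = 3 :=
    Polynomial.degree_X_pow_add_C (by norm_num) d
  refine Polynomial.irreducible_of_eisenstein_criterion (P := Ideal.span {p})
    ((Ideal.span_singleton_prime hp.ne_zero).2 hp.prime) ?_ ?_ ?_ ?_ hmonic.isPrimitive
  · rw [hmonic.leadingCoeff, ← Ideal.eq_top_iff_one, Ideal.span_singleton_eq_top]
    exact hp.not_isUnit
  · intro n hn
    rw [hdeg] at hn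
    have hn3 : n < 3 := by exact_mod_cast hn
    rw [Polynomial.coeff_add, Polynomial.coeff_X_pow, if_neg hn3.ne, zero_add, Polynomial.coeff_C]
    split_ifs
    · exact Ideal.mem_span_singleton.2 hpd
    · exact zero_mem _
  · rw [hdeg]
    norm_num
  · rw [Ideal.span_singleton_pow, Ideal.mem_span_singleton]
    simp only [Polynomial.coeff_add, Polynomial.coeff_X_pow, Polynomial.coeff_C_zero]
    intro h
    exact hp.not_isUnit (squarefree_C_mul_X_pow_three_add_C h3 hb p (by simpa [sq] using h))

end Irreducible

section Birational

variable {k σ A B K L : Type*} [Field k] [CommRing A] [Algebra k A] [CommRing B] [Algebra k B]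
  [Field K] [Algebra k K] [Field L] [Algebra k L]

theorem MvPolynomial.exists_pow_mul_aeval_div (α : A →ₐ[k] K) (β : A →ₐ[k] L) {s : A}
    (hα : α s ≠ 0) (hβ : β s ≠ 0) (a : σ → A) (P : MvPolynomial σ k) :
    ∃ (n : ℕ) (q : A), α q = α s ^ n * aeval (fun i => α (a i) / α s) P ∧
      β q = β s ^ n * aeval (fun i => β (a i) / β s) P := by
  induction P using MvPolynomial.induction_on with
  | C c => exact ⟨0, algebraMap k A c, by simp, by simp⟩
  | add P Q hP hQ =>
    obtain ⟨m, p, hpα, hpβ⟩ := hP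
    obtain ⟨n, q, hqα, hqβ⟩ := hQ
    refine ⟨m + n, s ^ n * p + s ^ m * q, ?_, ?_⟩
    · simp only [map_add, map_mul, map_pow, hpα, hqα]
      ring
    · simp only [map_add, map_mul, map_pow, hpβ, hqβ]
      ring
  | mul_X P i hP =>
    obtain ⟨m, p, hpα, hpβ⟩ := hP
    refine ⟨m + 1, p * a i, ?_, ?_⟩
    · simp only [map_mul, hpα, aeval_X]
      field_simp
      ring
    · simp only [map_mul, hpβ, aeval_X]
      field_simp
      ring

theorem MvPolynomial.aeval_div_eq_zero_of_injective {α : A →ₐ[k] K} (hinj : Function.Injective α)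
    (β : A →ₐ[k] L) {s : A} (hβ : β s ≠ 0) (a : σ → A) {P : MvPolynomial σ k}
    (hP : aeval (fun i => α (a i) / α s) P = 0) : aeval (fun i => β (a i) / β s) P = 0 := by
  have hα : α s ≠ 0 := fun h => hβ (by rw [(map_eq_zero_iff α hinj).1 h, map_zero])
  obtain ⟨n, q, hqα, hqβ⟩ := exists_pow_mul_aeval_div α β hα hβ a P
  rw [hP, mul_zero, map_eq_zero_iff α hinj] at hqα
  rw [hqα, map_zero] at hqβ
  exact (mul_eq_zero.1 hqβ.symm).resolve_left (pow_ne_zero n hβ)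

/-- Mutually inverse rational maps between two affine integral schemes induce an isomorphism of
function fields. -/
theorem nonempty_algEquiv_of_isFractionRing [Algebra A K] [IsFractionRing A K]
    [IsScalarTower k A K] [Algebra B L] [IsFractionRing B L] [IsScalarTower k B L]
    (φ : B →ₐ[k] K) (ψ : A →ₐ[k] L) (hφ : Function.Injective φ)
    (hinv : (IsFractionRing.liftAlgHom (K := L) hφ).comp ψ = Algebra.algHom k A K) :
    Nonempty (K ≃ₐ[k] L) := by
  refine ⟨(AlgEquiv.ofBijective (IsFractionRing.liftAlgHom (K := L) hφ)
    ⟨RingHom.injective _, ?_⟩).symm⟩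
  intro z
  obtain ⟨a, b, -, rfl⟩ := IsFractionRing.div_surjective (A := A) z
  refine ⟨ψ a / ψ b, ?_⟩
  rw [map_div₀]
  exact congrArg₂ (· / ·) (DFunLike.congr_fun hinv a) (DFunLike.congr_fun hinv b)

end Birational

section PlaneCurve

variable {k : Type*} [Field k]

theorem MvPolynomial.quotient_mk_ne_zero_of_eval {σ : Type*} {f P : MvPolynomial σ k} (p : σ → k)
    (hf : eval p f = 0) (hP : eval p P ≠ 0) : Ideal.Quotient.mk (Ideal.span {f}) P ≠ 0 := by
  intro h
  obtain ⟨q, rfl⟩ := Ideal.mem_span_singleton.1 (Ideal.Quotient.eq_zero_iff_mem.1 h)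
  exact hP (by rw [map_mul, hf, zero_mul])

end PlaneCurve

section CharTwo

variable {F : Type*} [Field F] {c : F}

theorem hermitian_to_twisted (h2 : (2 : F) = 0) (hc : c ^ 2 + c + 1 = 0) {x y : F}
    (h : x ^ 3 + y ^ 3 + 1 = 0) (hs : c * x * (x + y + 1) + (y + 1) ≠ 0) :
    (((y + 1) * (x + y + 1) + x * (x + y + 1) + (y + 1)) / (c * x * (x + y + 1) + (y + 1))) ^ 3
      + c * ((c ^ 2 * x * (x + y + 1) + (y + 1)) / (c * x * (x + y + 1) + (y + 1))) ^ 3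
      + c ^ 2 = 0 := by
  have key : ((y + 1) * (x + y + 1) + x * (x + y + 1) + (y + 1)) ^ 3
      + c * (c ^ 2 * x * (x + y + 1) + (y + 1)) ^ 3
      + c ^ 2 * (c * x * (x + y + 1) + (y + 1)) ^ 3 = 0 := by
    grind
  generalize c * x * (x + y + 1) + (y + 1) = s at *
  generalize c ^ 2 * x * (x + y + 1) + (y + 1) = v at *
  generalize (y + 1) * (x + y + 1) + x * (x + y + 1) + (y + 1) = u at *
  field_simp
  linear_combination key

theorem twisted_to_hermitian (h2 : (2 : F) = 0) (hc : c ^ 2 + c + 1 = 0) {U V : F}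
    (h : U ^ 3 + c * V ^ 3 + c ^ 2 = 0) (hE : (c * V + c ^ 2) * (U + c * V + c ^ 2) ≠ 0) :
    ((V + 1) * (U + c ^ 2 * V + c) / ((c * V + c ^ 2) * (U + c * V + c ^ 2))) ^ 3
      + ((U + c ^ 2 * V + c) ^ 2 / ((c * V + c ^ 2) * (U + c * V + c ^ 2)) + 1) ^ 3 + 1 = 0 := by
  have key : ((V + 1) * (U + c ^ 2 * V + c)) ^ 3
      + ((U + c ^ 2 * V + c) ^ 2 + (c * V + c ^ 2) * (U + c * V + c ^ 2)) ^ 3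
      + ((c * V + c ^ 2) * (U + c * V + c ^ 2)) ^ 3 = 0 := by
    grind
  generalize (c * V + c ^ 2) * (U + c * V + c ^ 2) = E at *
  generalize (V + 1) * (U + c ^ 2 * V + c) = M at *
  generalize (U + c ^ 2 * V + c) ^ 2 = N at *
  field_simp
  linear_combination key

theorem hermitian_to_twisted_to_hermitian (h2 : (2 : F) = 0) (hc : c ^ 2 + c + 1 = 0) {x y U V : F}
    (hy : y + 1 ≠ 0) (hxy : x + y + 1 ≠ 0) (hs : c * x * (x + y + 1) + (y + 1) ≠ 0)
    (hU : U = ((y + 1) * (x + y + 1) + x * (x + y + 1) + (y + 1)) / (c * x * (x + y + 1) + (y + 1)))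
    (hV : V = (c ^ 2 * x * (x + y + 1) + (y + 1)) / (c * x * (x + y + 1) + (y + 1))) :
    (V + 1) * (U + c ^ 2 * V + c) / ((c * V + c ^ 2) * (U + c * V + c ^ 2)) = x ∧
      (U + c ^ 2 * V + c) ^ 2 / ((c * V + c ^ 2) * (U + c * V + c ^ 2)) + 1 = y := by
  rw [eq_div_iff hs] at hU hV
  obtain ⟨s, hsdef⟩ : ∃ s, s = c * x * (x + y + 1) + (y + 1) := ⟨_, rfl⟩
  rw [← hsdef] at hs hU hV
  have hV1 : V + 1 = x * (x + y + 1) / s := by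
    rw [eq_div_iff hs]
    linear_combination hV + hsdef + x * (x + y + 1) * hc + ((y + 1) - x * (x + y + 1)) * h2
  have hT : U + c ^ 2 * V + c = (y + 1) * (x + y + 1) / s := by
    rw [eq_div_iff hs]
    linear_combination hU + c ^ 2 * hV + c * hsdef
      + (x * (x + y + 1) * (c ^ 2 - c + 1) + (y + 1)) * hc
  have hq : c * V + c ^ 2 = (y + 1) / s := by
    rw [eq_div_iff hs]
    linear_combination c * hV + c ^ 2 * hsdef + (y + 1) * hc
      + (c ^ 3 * x * (x + y + 1) - (y + 1)) * h2
  have hr : U + c * V + c ^ 2 = (x + y + 1) ^ 2 / s := by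
    rw [eq_div_iff hs]
    linear_combination hU + c * hV + c ^ 2 * hsdef + (y + 1) * hc + c ^ 3 * x * (x + y + 1) * h2
  rw [hV1, hT, hq, hr]
  constructor
  · field_simp
  · field_simp
    linear_combination h2

theorem twisted_to_hermitian_to_twisted (h2 : (2 : F) = 0) (hc : c ^ 2 + c + 1 = 0) {x y U V : F}
    (hT : U + c ^ 2 * V + c ≠ 0) (hq : c * V + c ^ 2 ≠ 0) (hr : U + c * V + c ^ 2 ≠ 0)
    (hx : x = (V + 1) * (U + c ^ 2 * V + c) / ((c * V + c ^ 2) * (U + c * V + c ^ 2)))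
    (hy : y = (U + c ^ 2 * V + c) ^ 2 / ((c * V + c ^ 2) * (U + c * V + c ^ 2)) + 1) :
    c * x * (x + y + 1) + (y + 1) ≠ 0 ∧
      ((y + 1) * (x + y + 1) + x * (x + y + 1) + (y + 1)) / (c * x * (x + y + 1) + (y + 1)) = U ∧
      (c ^ 2 * x * (x + y + 1) + (y + 1)) / (c * x * (x + y + 1) + (y + 1)) = V := by
  obtain ⟨T, hTdef⟩ : ∃ T, T = U + c ^ 2 * V + c := ⟨_, rfl⟩
  obtain ⟨q, hqdef⟩ : ∃ q, q = c * V + c ^ 2 := ⟨_, rfl⟩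
  obtain ⟨r, hrdef⟩ : ∃ r, r = U + c * V + c ^ 2 := ⟨_, rfl⟩
  rw [← hTdef] at hT
  rw [← hqdef] at hq
  rw [← hrdef] at hr
  rw [← hTdef, ← hqdef, ← hrdef] at hx hy
  have hrT : r = V + 1 + T := by grind
  have hy1 : y + 1 = T ^ 2 / (q * r) := by
    rw [hy]
    linear_combination h2
  have hxy : x + y + 1 = T / q := by
    rw [add_assoc, hy1, hx, ← add_div, div_eq_div_iff (mul_ne_zero hq hr) hq, hrT]
    ring
  have hs : c * x * (x + y + 1) + (y + 1) = T ^ 2 / (q ^ 2 * r) := by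
    have h1 : c * (V + 1) + q = 1 := by grind
    rw [hxy, hy1, hx]
    field_simp
    exact h1
  refine ⟨?_, ?_, ?_⟩
  · rw [hs]
    exact div_ne_zero (pow_ne_zero 2 hT) (mul_ne_zero (pow_ne_zero 2 hq) hr)
  · have h1 : T + (V + 1) + q = U := by grind
    rw [hs, hxy, hy1, hx]
    field_simp
    exact h1
  · have h1 : c ^ 2 * (V + 1) + q = V := by grind
    rw [hs, hxy, hy1, hx]
    field_simp
    exact h1

end CharTwo

section FunctionField

variable {k : Type*} [Field k]

theorem MvPolynomial.isDomain_quotient_span_singleton {σ : Type*} {f : MvPolynomial σ k}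
    (hf : Irreducible f) : IsDomain (MvPolynomial σ k ⧸ Ideal.span {f}) := by
  rw [Ideal.Quotient.isDomain_iff_prime]
  exact (Ideal.span_singleton_prime hf.ne_zero).2 hf.prime

theorem MvPolynomial.exists_algHom_quotient_span_singleton {σ S : Type*} [CommRing S] [Algebra k S]
    {f : MvPolynomial σ k} {p : σ → S} (hp : aeval p f = 0) :
    ∃ φ : (MvPolynomial σ k ⧸ Ideal.span {f}) →ₐ[k] S,
      ∀ P, φ (Ideal.Quotient.mkₐ k _ P) = aeval p P := by
  refine ⟨Ideal.Quotient.liftₐ _ (aeval p) fun P hP => ?_, fun P => rfl⟩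
  obtain ⟨q, rfl⟩ := Ideal.mem_span_singleton.1 hP
  rw [map_mul, hp, zero_mul]

theorem MvPolynomial.exists_algHom_fractionRing_quotient {σ : Type*} (f : MvPolynomial σ k)
    (K : Type*) [Field K] [Algebra k K] [Algebra (MvPolynomial σ k ⧸ Ideal.span {f}) K]
    [IsScalarTower k (MvPolynomial σ k ⧸ Ideal.span {f}) K]
    [IsFractionRing (MvPolynomial σ k ⧸ Ideal.span {f}) K] :
    ∃ ι : MvPolynomial σ k →ₐ[k] K, ι f = 0 ∧
      (∀ P, ι P = Algebra.algHom k _ K (Ideal.Quotient.mkₐ k (Ideal.span {f}) P)) ∧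
      ∀ p : σ → k, eval p f = 0 → ∀ P, eval p P ≠ 0 → ι P ≠ 0 := by
  refine ⟨(Algebra.algHom k _ K).comp (Ideal.Quotient.mkₐ k (Ideal.span {f})), ?_, fun P => rfl, ?_⟩
  · rw [AlgHom.comp_apply, Ideal.Quotient.mkₐ_eq_mk,
      Ideal.Quotient.eq_zero_iff_mem.2 (Ideal.mem_span_singleton_self f), map_zero]
  · intro p hp P hP h
    exact quotient_mk_ne_zero_of_eval p hp hP
      ((map_eq_zero_iff _ (IsFractionRing.injective (MvPolynomial σ k ⧸ Ideal.span {f}) K)).1 h)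

theorem nonempty_algEquiv_hermitian_twisted (h2 : (2 : k) = 0) {ω : k} (hω : ω ^ 2 + ω + 1 = 0)
    {f g : MvPolynomial (Fin 2) k} (hf : f = X 0 ^ 3 + X 1 ^ 3 + 1)
    (hg : g = X 0 ^ 3 + C ω * X 1 ^ 3 + C (ω ^ 2))
    (K L : Type*) [Field K] [Algebra k K] [Algebra (MvPolynomial (Fin 2) k ⧸ Ideal.span {f}) K]
    [IsScalarTower k (MvPolynomial (Fin 2) k ⧸ Ideal.span {f}) K]
    [IsFractionRing (MvPolynomial (Fin 2) k ⧸ Ideal.span {f}) K]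
    [Field L] [Algebra k L] [Algebra (MvPolynomial (Fin 2) k ⧸ Ideal.span {g}) L]
    [IsScalarTower k (MvPolynomial (Fin 2) k ⧸ Ideal.span {g}) L]
    [IsFractionRing (MvPolynomial (Fin 2) k ⧸ Ideal.span {g}) L] :
    Nonempty (K ≃ₐ[k] L) := by
  obtain ⟨ιA, hιf, hιA, hAne⟩ := exists_algHom_fractionRing_quotient f K
  obtain ⟨ιB, hιg, hιB, hBne⟩ := exists_algHom_fractionRing_quotient g L
  have hω0 : ω ≠ 0 := by
    rintro rfl
    simp at hω
  have hω1 : ω + 1 ≠ 0 := fun h => pow_ne_zero 2 hω0 (by linear_combination hω - h)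
  specialize hAne ![0, ω] (by
    simp only [hf, map_add, map_pow, map_one, eval_X, Matrix.cons_val_zero, Matrix.cons_val_one]
    linear_combination (ω - 1) * hω + h2)
  specialize hBne ![ω, 1] (by
    simp only [hg, map_add, map_mul, map_pow, eval_X, eval_C, Matrix.cons_val_zero,
      Matrix.cons_val_one]
    linear_combination ω * hω)
  have h2K : (2 : K) = 0 := by rw [← map_ofNat (algebraMap k K), h2, map_zero]
  have h2L : (2 : L) = 0 := by rw [← map_ofNat (algebraMap k L), h2, map_zero]
  have hωK : algebraMap k K ω ^ 2 + algebraMap k K ω + 1 = 0 := by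
    simpa using congrArg (algebraMap k K) hω
  have hωL : algebraMap k L ω ^ 2 + algebraMap k L ω + 1 = 0 := by
    simpa using congrArg (algebraMap k L) hω
  have hιAC (c : k) : ιA (C c) = algebraMap k K c := ιA.commutes c
  have hιBC (c : k) : ιB (C c) = algebraMap k L c := ιB.commutes c
  obtain ⟨x, hx⟩ : ∃ x, x = ιA (X 0) := ⟨_, rfl⟩
  obtain ⟨y, hy⟩ : ∃ y, y = ιA (X 1) := ⟨_, rfl⟩
  obtain ⟨U, hU⟩ : ∃ U, U = ιB (X 0) := ⟨_, rfl⟩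
  obtain ⟨V, hV⟩ : ∃ V, V = ιB (X 1) := ⟨_, rfl⟩
  have hxy : x ^ 3 + y ^ 3 + 1 = 0 := by
    simpa [hf, ← hx, ← hy] using hιf
  have hUV : U ^ 3 + algebraMap k L ω * V ^ 3 + algebraMap k L ω ^ 2 = 0 := by
    simpa [hg, ← hU, ← hV, hιBC] using hιg
  have hy0 : y + 1 ≠ 0 := by
    have h := hAne (X 1 + 1) (by simpa using hω1)
    simpa only [map_add, map_mul, map_pow, map_one, ← hx, ← hy, hιAC] using h
  have hxy0 : x + y + 1 ≠ 0 := by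
    have h := hAne (X 0 + X 1 + 1) (by simpa using hω1)
    simpa only [map_add, map_mul, map_pow, map_one, ← hx, ← hy, hιAC] using h
  have hs0 : algebraMap k K ω * x * (x + y + 1) + (y + 1) ≠ 0 := by
    have h := hAne (C ω * X 0 * (X 0 + X 1 + 1) + (X 1 + 1))
      (by simpa using hω1)
    simpa only [map_add, map_mul, map_pow, map_one, ← hx, ← hy, hιAC] using h
  have hT0 : U + algebraMap k L ω ^ 2 * V + algebraMap k L ω ≠ 0 := by
    have h := hBne (X 0 + C ω ^ 2 * X 1 + C ω) (by
      simpa using fun h : ω + ω ^ 2 + ω = 0 => hω1 (by linear_combination hω - h + ω * h2))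
    simpa only [map_add, map_mul, map_pow, map_one, ← hU, ← hV, hιBC] using h
  have hq0 : algebraMap k L ω * V + algebraMap k L ω ^ 2 ≠ 0 := by
    have h := hBne (C ω * X 1 + C ω ^ 2) (by
      simpa using fun h : ω + ω ^ 2 = 0 => one_ne_zero (α := k) (by linear_combination hω - h))
    simpa only [map_add, map_mul, map_pow, map_one, ← hU, ← hV, hιBC] using h
  have hr0 : U + algebraMap k L ω * V + algebraMap k L ω ^ 2 ≠ 0 := by
    have h := hBne (X 0 + C ω * X 1 + C ω ^ 2) (by
      simpa using fun h : ω + ω + ω ^ 2 = 0 => hω1 (by linear_combination hω - h + ω * h2))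
    simpa only [map_add, map_mul, map_pow, map_one, ← hU, ← hV, hιBC] using h
  have hg_aeval {u v : K} (h : u ^ 3 + algebraMap k K ω * v ^ 3 + algebraMap k K ω ^ 2 = 0) :
      aeval ![u, v] g = 0 := by
    simpa [hg] using h
  have hf_aeval {u v : L} (h : u ^ 3 + v ^ 3 + 1 = 0) : aeval ![u, v] f = 0 := by
    simpa [hf] using h
  obtain ⟨φ, hφ⟩ := exists_algHom_quotient_span_singleton
    (hg_aeval (hermitian_to_twisted h2K hωK hxy hs0))
  obtain ⟨ψ, hψ⟩ := exists_algHom_quotient_span_singleton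
    (hf_aeval (twisted_to_hermitian h2L hωL hUV (mul_ne_zero hq0 hr0)))
  have hψx := hψ (X 0)
  have hψy := hψ (X 1)
  simp only [aeval_X, Matrix.cons_val_zero, Matrix.cons_val_one] at hψx hψy
  obtain ⟨hβs, hβU, hβV⟩ := twisted_to_hermitian_to_twisted h2L hωL hT0 hq0 hr0 hψx hψy
  let s : MvPolynomial (Fin 2) k := C ω * X 0 * (X 0 + X 1 + 1) + (X 1 + 1)
  let a : Fin 2 → MvPolynomial (Fin 2) k :=
    ![(X 1 + 1) * (X 0 + X 1 + 1) + X 0 * (X 0 + X 1 + 1) + (X 1 + 1),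
      C ω ^ 2 * X 0 * (X 0 + X 1 + 1) + (X 1 + 1)]
  have hψC (c : k) : ψ (Ideal.Quotient.mkₐ k _ (C c)) = algebraMap k L c := by
    rw [hψ, aeval_C]
  have hφinj : Function.Injective φ := by
    rw [injective_iff_map_eq_zero]
    intro b hb
    obtain ⟨P, rfl⟩ := Ideal.Quotient.mkₐ_surjective k _ b
    rw [hφ] at hb
    have hβ := aeval_div_eq_zero_of_injective
      (α := Algebra.algHom k (MvPolynomial (Fin 2) k ⧸ Ideal.span {f}) K)
      (IsFractionRing.injective _ K) ψ (s := Ideal.Quotient.mkₐ k _ s)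
      (by simpa only [s, map_add, map_mul, map_one, hψC] using hβs)
      (fun i => Ideal.Quotient.mkₐ k _ (a i)) (P := P) (by
        simp only [← hιA]
        convert hb using 2
        congr 1
        refine funext (Fin.forall_fin_two.2 ⟨?_, ?_⟩) <;> simp [a, s, hιAC, ← hx, ← hy])
    have hcoord : (fun i => ψ (Ideal.Quotient.mkₐ k _ (a i)) / ψ (Ideal.Quotient.mkₐ k _ s))
        = fun i => ιB (X i) := by
      refine funext (Fin.forall_fin_two.2 ⟨?_, ?_⟩)
      · simpa only [a, s, Matrix.cons_val_zero, Matrix.cons_val_one, map_add,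
          map_mul, map_pow, map_one, hψC, ← hU] using hβU
      · simpa only [a, s, Matrix.cons_val_zero, Matrix.cons_val_one, map_add,
          map_mul, map_pow, map_one, hψC, ← hV] using hβV
    rw [hcoord, ← Function.comp_def, ← aeval_unique, hιB] at hβ
    exact (map_eq_zero_iff _ (IsFractionRing.injective _ L)).1 hβ
  refine nonempty_algEquiv_of_isFractionRing φ ψ hφinj ?_
  have hlift (P) : IsFractionRing.liftAlgHom (K := L) hφinj (ιB P)
      = φ (Ideal.Quotient.mkₐ k _ P) := by
    rw [hιB]
    exact IsFractionRing.lift_algebraMap hφinj _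
  have hφU := hφ (X 0)
  have hφV := hφ (X 1)
  simp only [aeval_X, Matrix.cons_val_zero, Matrix.cons_val_one] at hφU hφV
  rw [← hlift, ← hU] at hφU
  rw [← hlift, ← hV] at hφV
  obtain ⟨hinvx, hinvy⟩ := hermitian_to_twisted_to_hermitian h2K hωK hy0 hxy0 hs0 hφU hφV
  refine Ideal.Quotient.algHom_ext _ (MvPolynomial.algHom_ext fun i => ?_)
  simp only [AlgHom.comp_apply, ← hιA]
  fin_cases i
  · change IsFractionRing.liftAlgHom (K := L) hφinj (ψ (Ideal.Quotient.mkₐ k _ (X 0))) = ιA (X 0)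
    rw [hψx, ← hx, ← hinvx]
    simp only [map_add, map_mul, map_div₀, map_pow, map_one, AlgHom.commutes]
  · change IsFractionRing.liftAlgHom (K := L) hφinj (ψ (Ideal.Quotient.mkₐ k _ (X 1))) = ιA (X 1)
    rw [hψy, ← hy, ← hinvy]
    simp only [map_add, map_mul, map_div₀, map_pow, map_one, AlgHom.commutes]

end FunctionField

/-- The function field over `F₄` of the Hermitian curve `x₀³ + x₁³ + x₂³ = 0` (affinely
`x³ + y³ + 1 = 0`) is isomorphic as an `F₄`-algebra to the function field of the curve
`x₀³ + ωx₁³ + ω²x₂³ = 0` (affinely `x³ + ωy³ + ω² = 0`), where `F₄ = F₂[ω]`. -/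
theorem stmt_19 (ω : GaloisField 2 2) (hω : ω ^ 2 + ω + 1 = 0) :
    Nonempty
      ((FractionRing (MvPolynomial (Fin 2) (GaloisField 2 2) ⧸
          Ideal.span {(X 0 : MvPolynomial (Fin 2) (GaloisField 2 2)) ^ 3 + X 1 ^ 3 + 1}))
        ≃ₐ[GaloisField 2 2]
       (FractionRing (MvPolynomial (Fin 2) (GaloisField 2 2) ⧸
          Ideal.span {(X 0 : MvPolynomial (Fin 2) (GaloisField 2 2)) ^ 3
            + C ω * X 1 ^ 3 + C (ω ^ 2)}))) := by
  have h2 : (2 : GaloisField 2 2) = 0 := CharTwo.two_eq_zero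
  have h3 : (3 : GaloisField 2 2) ≠ 0 := fun h => one_ne_zero (by linear_combination h - h2)
  have hω0 : ω ≠ 0 := by
    rintro rfl
    simp at hω
  have hf := isDomain_quotient_span_singleton (irreducible_X_pow_three_add_C_mul_X_pow_three_add_C h3
    (one_ne_zero (α := GaloisField 2 2)) (one_ne_zero (α := GaloisField 2 2)))
  rw [C_1, one_mul] at hf
  have hg := isDomain_quotient_span_singleton
    (irreducible_X_pow_three_add_C_mul_X_pow_three_add_C h3 hω0 (pow_ne_zero 2 hω0))
  exact nonempty_algEquiv_hermitian_twisted h2 hω rfl rfl _ _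
end
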